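/- Let (w^N)_{N∈ℕ}, w^N∈[0,1]^{N×N} symmetric with zero diagonal, be such that for every N Assumption (G1) holds and Assumption (G2) holds with a constant c₀>0 independent of N; let α̂^N∈𝒜^N denote the unique Nash equilibrium of the N-player graph game. Let W be a graphon such that Assumptions (G3) and (G4) hold, with unique graphon game Nash equilibrium α̂∈𝒜^∞. Let W^N be the step graphon of w^N and suppose there is a bounded function ψ:[0,∞)→[0,∞) with (𝔼[∫₀¹∫₀^T(b^u_t−b^{u,N}_{t,step})²dt du])^{1/2} ≤ ψ(N) and ψ(N)→0 as N→∞. Then there exists a constant K>0 such that for all N∈ℕ: 𝔼[∫₀¹∫₀^T(α̂^u_t−α̂^{u,N}_{t,step})²dt du] ≤ K(ψ(N)+√(‖W−W^N‖_□)). In particular, if ‖W−W^N‖_□→0, the left-hand side converges to 0. -/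

import Mathlib

open MeasureTheory Set Filter

noncomputable section

/-- Inner product on `L²([0,T],ℝ)`. -/
def ip (T : ℝ) (f g : ℝ → ℝ) : ℝ := ∫ t in Icc (0:ℝ) T, f t * g t

/-- Integral operator induced by a kernel `G`. -/
def opK (T : ℝ) (G : ℝ → ℝ → ℝ) (f : ℝ → ℝ) : ℝ → ℝ :=
  fun t => ∫ s in Icc (0:ℝ) T, G t s * f s

/-- Integral operator induced by the adjoint kernel `G*(t,s) = G(s,t)`. -/
def opKadj (T : ℝ) (G : ℝ → ℝ → ℝ) (f : ℝ → ℝ) : ℝ → ℝ :=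
  fun t => ∫ s in Icc (0:ℝ) T, G s t * f s

/-- `G ∈ L²([0,T]²,ℝ)`. -/
def IsL2Kernel (T : ℝ) (G : ℝ → ℝ → ℝ) : Prop :=
  Measurable (Function.uncurry G) ∧
    Integrable (fun p : ℝ × ℝ => (G p.1 p.2) ^ 2)
      ((volume.restrict (Icc (0:ℝ) T)).prod (volume.restrict (Icc (0:ℝ) T)))

/-- Volterra kernel in `𝒢`: square integrable on `[0,T]²` and vanishing for `s ≥ t`. -/
def IsVolterraKernel (T : ℝ) (G : ℝ → ℝ → ℝ) : Prop :=
  IsL2Kernel T G ∧ ∀ t s : ℝ, t ≤ s → G t s = 0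

/-- Membership in `L²([0,T],ℝ)`. -/
def MemL2 (T : ℝ) (f : ℝ → ℝ) : Prop :=
  Measurable f ∧ Integrable (fun t => (f t) ^ 2) (volume.restrict (Icc (0:ℝ) T))

/-- Membership in `L²([0,T],ℝ^N)`. -/
def MemL2N (T : ℝ) {N : ℕ} (f : ℝ → Fin N → ℝ) : Prop :=
  (∀ i, Measurable fun t => f t i) ∧
    Integrable (fun t => ∑ i, (f t i) ^ 2) (volume.restrict (Icc (0:ℝ) T))

variable {Ω : Type}

/-- Square-integrability of a process on `[0,T] × Ω`. -/
def SqInt (T : ℝ) [MeasurableSpace Ω] (P : Measure Ω) (α : ℝ → Ω → ℝ) : Prop :=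
  Integrable (fun p : ℝ × Ω => (α p.1 p.2) ^ 2) ((volume.restrict (Icc (0:ℝ) T)).prod P)

/-- Admissible control: progressively measurable and square integrable on `[0,T] × Ω`. -/
def Admissible (T : ℝ) {mΩ : MeasurableSpace Ω} (F : Filtration ℝ mΩ) (P : Measure Ω)
    (α : ℝ → Ω → ℝ) : Prop :=
  ProgMeasurable F α ∧ SqInt T P α

/-- Objective functional `J₀^{i,N}` of player `i` in the `N`-player game on a weighted
graph with interaction matrix `w`. -/
def Jgraph (T : ℝ) {mΩ : MeasurableSpace Ω} (P : Measure Ω) {N : ℕ}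
    (Atil Btil Ctil : ℝ → ℝ → ℝ) (lam : ℝ) (w : Fin N → Fin N → ℝ)
    (b : Fin N → ℝ → Ω → ℝ) (bstar : ℝ → Ω → ℝ) (c : Fin N → Ω → ℝ)
    (i : Fin N) (α : Fin N → ℝ → Ω → ℝ) : ℝ :=
  ∫ ω,
    (- ip T (fun t => α i t ω)
        (fun t => opK T Atil (fun s => α i s ω) t + lam * α i t ω)
      - (1 / (N:ℝ)) * ∑ j, w i j *
          ip T (fun t => α i t ω)
            (fun t => opK T Btil (fun s => α j s ω) t + opKadj T Btil (fun s => α j s ω) t)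
      - (1 / (N:ℝ)^2) * ∑ j, ∑ k, w i j * w i k *
          ip T (fun t => α j t ω) (opK T Ctil (fun s => α k s ω))
      + ip T (fun t => b i t ω) (fun t => α i t ω)
      + (1 / (N:ℝ)) * ∑ j, w i j * ip T (fun t => bstar t ω) (fun t => α j t ω)
      + c i ω) ∂P

/-- Nash equilibrium of the `N`-player graph game. -/
def IsNashGraph (T : ℝ) {mΩ : MeasurableSpace Ω} (F : Filtration ℝ mΩ) (P : Measure Ω) {N : ℕ}
    (Atil Btil Ctil : ℝ → ℝ → ℝ) (lam : ℝ) (w : Fin N → Fin N → ℝ)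
    (b : Fin N → ℝ → Ω → ℝ) (bstar : ℝ → Ω → ℝ) (c : Fin N → Ω → ℝ)
    (α : Fin N → ℝ → Ω → ℝ) : Prop :=
  (∀ i, Admissible T F P (α i)) ∧
    ∀ (i : Fin N) (β : ℝ → Ω → ℝ), Admissible T F P β →
      Jgraph T P Atil Btil Ctil lam w b bstar c i (Function.update α i β)
        ≤ Jgraph T P Atil Btil Ctil lam w b bstar c i α

/-- Assumption (G2): coercivity of `λI + 𝐀̃ + (1/N) w ⋅ 𝐁̃` on `L²([0,T],ℝ^N)`. -/
def CoercGraph (T : ℝ) {N : ℕ} (Atil Btil : ℝ → ℝ → ℝ) (lam : ℝ)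
    (w : Fin N → Fin N → ℝ) (c₀ : ℝ) : Prop :=
  ∀ f : ℝ → Fin N → ℝ, MemL2N T f →
    c₀ * (∫ t in Icc (0:ℝ) T, ∑ i, (f t i) ^ 2) ≤
      ∫ t in Icc (0:ℝ) T, ∑ i, f t i *
        (lam * f t i + opK T Atil (fun s => f s i) t
          + (1 / (N:ℝ)) * ∑ j, w i j * opK T Btil (fun s => f s j) t)

/-- A graphon: Borel-measurable, symmetric, `[0,1]`-valued. -/
def IsGraphon (W : ℝ → ℝ → ℝ) : Prop :=
  Measurable (Function.uncurry W) ∧ (∀ u v, W u v = W v u) ∧ ∀ u v, W u v ∈ Icc (0:ℝ) 1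

/-- Membership in `L²([0,T]×[0,1],ℝ)` (first variable: time, second variable: label). -/
def MemL2TI (T : ℝ) (g : ℝ → ℝ → ℝ) : Prop :=
  Measurable (Function.uncurry g) ∧
    Integrable (fun p : ℝ × ℝ => (g p.1 p.2) ^ 2)
      ((volume.restrict (Icc (0:ℝ) T)).prod (volume.restrict (Icc (0:ℝ) 1)))

/-- Objective functional `J^{u,W}` of player `u` in the graphon game. -/
def Jgr (T : ℝ) {mΩ : MeasurableSpace Ω} (P : Measure Ω)
    (Atil Btil Ctil : ℝ → ℝ → ℝ) (lam : ℝ) (W : ℝ → ℝ → ℝ)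
    (b : ℝ → ℝ → Ω → ℝ) (bstar : ℝ → Ω → ℝ) (c : ℝ → Ω → ℝ)
    (u : ℝ) (α : ℝ → ℝ → Ω → ℝ) : ℝ :=
  ∫ ω,
    (- ip T (fun t => α u t ω)
        (fun t => opK T Atil (fun s => α u s ω) t + lam * α u t ω)
      - ip T (fun t => α u t ω)
          (fun t => opK T Btil (fun s => ∫ v in Icc (0:ℝ) 1, W u v * α v s ω) t
            + opKadj T Btil (fun s => ∫ v in Icc (0:ℝ) 1, W u v * α v s ω) t)
      - ip T (fun t => ∫ v in Icc (0:ℝ) 1, W u v * α v t ω)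
          (opK T Ctil (fun s => ∫ v in Icc (0:ℝ) 1, W u v * α v s ω))
      + ip T (fun t => b u t ω) (fun t => α u t ω)
      + ip T (fun t => bstar t ω) (fun t => ∫ v in Icc (0:ℝ) 1, W u v * α v t ω)
      + c u ω) ∂P

/-- Admissible strategy profile of the graphon game. -/
def AdmProfile (T : ℝ) {mΩ : MeasurableSpace Ω} (F : Filtration ℝ mΩ) (P : Measure Ω)
    (α : ℝ → ℝ → Ω → ℝ) : Prop :=
  Measurable (fun q : ℝ × ℝ × Ω => α q.1 q.2.1 q.2.2) ∧
    (∀ u ∈ Icc (0:ℝ) 1, ProgMeasurable F (α u)) ∧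
    (∀ᵐ u ∂(volume.restrict (Icc (0:ℝ) 1)), SqInt T P (α u)) ∧
    Integrable (fun q : ℝ × ℝ × Ω => (α q.1 q.2.1 q.2.2) ^ 2)
      ((volume.restrict (Icc (0:ℝ) 1)).prod ((volume.restrict (Icc (0:ℝ) T)).prod P))

/-- Graphon game Nash equilibrium: for a.e. label `u`, the control `α u` maximizes
the objective of player `u` among all admissible deviations. -/
def IsGraphonNash (T : ℝ) {mΩ : MeasurableSpace Ω} (F : Filtration ℝ mΩ) (P : Measure Ω)
    (Atil Btil Ctil : ℝ → ℝ → ℝ) (lam : ℝ) (W : ℝ → ℝ → ℝ)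
    (b : ℝ → ℝ → Ω → ℝ) (bstar : ℝ → Ω → ℝ) (c : ℝ → Ω → ℝ)
    (α : ℝ → ℝ → Ω → ℝ) : Prop :=
  AdmProfile T F P α ∧
    ∀ᵐ u ∂(volume.restrict (Icc (0:ℝ) 1)),
      ∀ β : ℝ → Ω → ℝ, ProgMeasurable F β → SqInt T P β →
        Jgr T P Atil Btil Ctil lam W b bstar c u (Function.update α u β)
          ≤ Jgr T P Atil Btil Ctil lam W b bstar c u α

/-- Index of the partition interval `𝒫^N_i` containing `u`. -/
def stepIdx (N : ℕ) (u : ℝ) : ℕ := min (Nat.floor (u * (N:ℝ))) (N - 1)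

/-- Step function on `[0,1]` built from an `N`-tuple (with junk value `x₀` if `N = 0`). -/
def stepOf {X : Type*} (x₀ : X) (N : ℕ) (g : Fin N → X) (u : ℝ) : X :=
  if h : stepIdx N u < N then g ⟨stepIdx N u, h⟩ else x₀

/-- Step graphon associated with the `N × N` interaction matrix `w`. -/
def stepW (N : ℕ) (w : Fin N → Fin N → ℝ) (u v : ℝ) : ℝ :=
  stepOf 0 N (fun i => stepOf 0 N (fun j => w i j) v) u

/-- Cut norm of a kernel on `[0,1]²`. -/
def cutNorm (U : ℝ → ℝ → ℝ) : ℝ :=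
  sSup {x : ℝ | ∃ S₁ S₂ : Set ℝ, MeasurableSet S₁ ∧ MeasurableSet S₂ ∧
    S₁ ⊆ Icc (0:ℝ) 1 ∧ S₂ ⊆ Icc (0:ℝ) 1 ∧ x = |∫ u in S₁, ∫ v in S₂, U u v|}


set_option linter.unusedSectionVars false
set_option linter.unusedVariables false
set_option linter.deprecated false

/-! ### Generic L² and kernel lemmas -/

def kop {Y : Type*} [MeasurableSpace Y] (m : Measure Y) (k : Y → Y → ℝ) (f : Y → ℝ) (x : Y) : ℝ :=
  ∫ y, k x y * f y ∂m

def L2 {X : Type*} [MeasurableSpace X] (μ : Measure X) (f : X → ℝ) : Prop :=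
  Measurable f ∧ Integrable (fun x => (f x) ^ 2) μ

section L2sec
variable {X : Type*} [MeasurableSpace X] {μ : Measure X} {f g : X → ℝ}

lemma L2.memLp (h : L2 μ f) : MemLp f 2 μ :=
  (memLp_two_iff_integrable_sq h.1.aestronglyMeasurable).2 h.2

lemma L2.of_memLp (hm : Measurable f) (h : MemLp f 2 μ) : L2 μ f :=
  ⟨hm, (memLp_two_iff_integrable_sq hm.aestronglyMeasurable).1 h⟩

lemma L2.add (hf : L2 μ f) (hg : L2 μ g) : L2 μ (fun x => f x + g x) :=
  L2.of_memLp (hf.1.add hg.1) (hf.memLp.add hg.memLp)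

lemma L2.sub (hf : L2 μ f) (hg : L2 μ g) : L2 μ (fun x => f x - g x) :=
  L2.of_memLp (hf.1.sub hg.1) (hf.memLp.sub hg.memLp)

lemma L2.smul (c : ℝ) (hf : L2 μ f) : L2 μ (fun x => c * f x) :=
  L2.of_memLp (hf.1.const_mul c) (hf.memLp.const_mul c)

lemma L2.int_mul (hf : L2 μ f) (hg : L2 μ g) : Integrable (fun x => f x * g x) μ :=
  hf.memLp.integrable_mul hg.memLp

lemma L2.sq_nonneg_int : 0 ≤ ∫ x, (f x) ^ 2 ∂μ := integral_nonneg fun x => sq_nonneg _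

lemma L2.cs (hf : L2 μ f) (hg : L2 μ g) :
    (∫ x, f x * g x ∂μ) ^ 2 ≤ (∫ x, (f x) ^ 2 ∂μ) * (∫ x, (g x) ^ 2 ∂μ) := by
  have key : ∀ t : ℝ, 0 ≤ (∫ x, (f x) ^ 2 ∂μ) * (t * t) + (2 * ∫ x, f x * g x ∂μ) * t
      + ∫ x, (g x) ^ 2 ∂μ := by
    intro t
    have h : ∫ x, (t * f x + g x) ^ 2 ∂μ = (∫ x, (f x) ^ 2 ∂μ) * (t * t)
        + (2 * ∫ x, f x * g x ∂μ) * t + ∫ x, (g x) ^ 2 ∂μ := by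
      have e : ∀ x, (t * f x + g x) ^ 2 = (t * t) * (f x) ^ 2 + (2 * t) * (f x * g x) + (g x) ^ 2 := by
        intro x; ring
      simp_rw [e]
      have h1 : Integrable (fun x => (t * t) * (f x) ^ 2 + (2 * t) * (f x * g x)) μ :=
        (hf.2.const_mul _).add ((hf.int_mul hg).const_mul _)
      rw [integral_add h1 hg.2,
        integral_add (hf.2.const_mul _) ((hf.int_mul hg).const_mul _), integral_const_mul,
        integral_const_mul]
      ring
    rw [← h]
    exact integral_nonneg fun x => sq_nonneg _
  have := discrim_le_zero key
  unfold discrim at this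
  nlinarith

lemma L2.of_bdd [IsFiniteMeasure μ] (hm : Measurable f) (C : ℝ) (h : ∀ x, |f x| ≤ C) : L2 μ f := by
  refine L2.of_memLp hm ?_
  exact MemLp.of_bound hm.aestronglyMeasurable C (Eventually.of_forall h)

end L2sec

/-- bounded kernel operators -/
structure Bd {Y : Type*} [MeasurableSpace Y] (m : Measure Y) (k : Y → Y → ℝ) (C : ℝ) : Prop where
  meas : Measurable (Function.uncurry k)
  int : Integrable (fun p : Y × Y => (k p.1 p.2) ^ 2) (m.prod m)
  C0 : 0 ≤ C
  bd : ∀ f, L2 m f → ∫ x, (kop m k f x) ^ 2 ∂m ≤ C * ∫ x, (f x) ^ 2 ∂m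

section kopsec
variable {Y : Type*} [MeasurableSpace Y] {m : Measure Y} [SFinite m] {k : Y → Y → ℝ} {C : ℝ}

lemma row_L2 (hk : Measurable (Function.uncurry k))
    (hi : Integrable (fun p : Y × Y => (k p.1 p.2) ^ 2) (m.prod m)) :
    ∀ᵐ x ∂m, L2 m (k x) := by
  filter_upwards [hi.prod_right_ae] with x hx
  exact ⟨hk.comp measurable_prodMk_left, hx⟩

lemma kop_meas_param {Z : Type*} [MeasurableSpace Z] (hk : Measurable (Function.uncurry k))
    {f : Z → Y → ℝ} (hf : Measurable (Function.uncurry f)) :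
    Measurable (fun p : Z × Y => kop m k (f p.1) p.2) := by
  unfold kop
  have : StronglyMeasurable (Function.uncurry (fun (p : Z × Y) (y : Y) => k p.2 y * f p.1 y)) := by
    apply Measurable.stronglyMeasurable
    apply Measurable.mul
    · exact hk.comp ((measurable_snd.comp measurable_fst).prodMk measurable_snd)
    · exact hf.comp ((measurable_fst.comp measurable_fst).prodMk measurable_snd)
  exact this.integral_prod_right.measurable

lemma kop_meas (hk : Measurable (Function.uncurry k)) {f : Y → ℝ} (hf : Measurable f) :
    Measurable (kop m k f) := by
  have := kop_meas_param (m := m) (Z := Unit) hk (f := fun _ => f) (hf.comp measurable_snd)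
  exact this.comp (measurable_const.prodMk measurable_id : Measurable (fun y : Y => ((), y)))

lemma kop_row_bd {f : Y → ℝ} (hf : L2 m f) {x : Y} (hx : L2 m (k x)) :
    (kop m k f x) ^ 2 ≤ (∫ y, (k x y) ^ 2 ∂m) * ∫ y, (f y) ^ 2 ∂m := hx.cs hf

lemma kop_L2 (hk : Measurable (Function.uncurry k))
    (hi : Integrable (fun p : Y × Y => (k p.1 p.2) ^ 2) (m.prod m)) {f : Y → ℝ} (hf : L2 m f) :
    L2 m (kop m k f) := by
  refine ⟨kop_meas hk hf.1, ?_⟩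
  refine Integrable.mono' (hi.integral_prod_left.mul_const (∫ y, (f y) ^ 2 ∂m))
    ((kop_meas hk hf.1).pow_const 2).aestronglyMeasurable ?_
  filter_upwards [row_L2 hk hi] with x hx
  rw [Real.norm_of_nonneg (sq_nonneg _)]
  exact kop_row_bd hf hx

lemma Bd.of_int (hk : Measurable (Function.uncurry k))
    (hi : Integrable (fun p : Y × Y => (k p.1 p.2) ^ 2) (m.prod m)) :
    Bd m k (∫ p, (k p.1 p.2) ^ 2 ∂(m.prod m)) := by
  refine ⟨hk, hi, integral_nonneg fun _ => sq_nonneg _, fun f hf => ?_⟩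
  rw [integral_prod _ hi, ← integral_mul_const]
  refine integral_mono_ae (kop_L2 hk hi hf).2 (hi.integral_prod_left.mul_const _) ?_
  filter_upwards [row_L2 hk hi] with x hx
  exact kop_row_bd hf hx

lemma Bd.swap (h : Bd m k C) : Bd m (fun a b => k b a)
    (∫ p, (k p.2 p.1) ^ 2 ∂(m.prod m)) :=
  Bd.of_int (h.meas.comp measurable_swap) h.int.swap

lemma Bd.L2 (h : Bd m k C) {f : Y → ℝ} (hf : L2 m f) : L2 m (kop m k f) := kop_L2 h.meas h.int hf

lemma kop_adj (h : Bd m k C) {f g : Y → ℝ} (hf : _root_.L2 m f) (hg : _root_.L2 m g) :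
    ∫ x, g x * kop m k f x ∂m = ∫ x, kop m (fun a b => k b a) g x * f x ∂m := by
  have hgf : _root_.L2 (m.prod m) (fun p : Y × Y => g p.1 * f p.2) := by
    refine ⟨(hg.1.comp measurable_fst).mul (hf.1.comp measurable_snd), ?_⟩
    simp_rw [mul_pow]
    exact hg.2.mul_prod hf.2
  have hint : Integrable (fun p : Y × Y => k p.1 p.2 * (g p.1 * f p.2)) (m.prod m) :=
    L2.int_mul ⟨h.meas, h.int⟩ hgf
  have := integral_integral_swap (f := fun x y => k x y * (g x * f y)) hint
  unfold kop
  calc ∫ x, g x * ∫ y, k x y * f y ∂m ∂m = ∫ x, ∫ y, k x y * (g x * f y) ∂m ∂m := by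
        congr 1; ext x; rw [← integral_const_mul]; congr 1; ext y; ring
    _ = _ := this
    _ = _ := by
        congr 1; ext x; rw [← integral_mul_const]; congr 1; ext y; ring

variable {X Z : Type*} [MeasurableSpace X] [MeasurableSpace Z] {μ : Measure X} {ζ : Measure Z}
  [SFinite ζ]

lemma L2.slice {f : Z → Y → ℝ} (hf : L2 (ζ.prod m) (fun p => f p.1 p.2)) :
    ∀ᵐ z ∂ζ, L2 m (f z) := by
  filter_upwards [hf.2.prod_right_ae] with z hz
  exact ⟨hf.1.comp measurable_prodMk_left, hz⟩

lemma par_op0 (h : Bd m k C) {f : Z → Y → ℝ} (hf : L2 (ζ.prod m) (fun p => f p.1 p.2)) :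
    L2 (ζ.prod m) (fun p => kop m k (f p.1) p.2) ∧
    ∫ p, (kop m k (f p.1) p.2) ^ 2 ∂(ζ.prod m) ≤ C * ∫ p, (f p.1 p.2) ^ 2 ∂(ζ.prod m) := by
  have hm : Measurable (fun p : Z × Y => kop m k (f p.1) p.2) := kop_meas_param h.meas hf.1
  have hi : Integrable (fun p : Z × Y => (kop m k (f p.1) p.2) ^ 2) (ζ.prod m) := by
    rw [integrable_prod_iff (hm.pow_const 2).aestronglyMeasurable]
    constructor
    · filter_upwards [hf.slice] with z hz
      exact (h.L2 hz).2
    · refine Integrable.mono' (hf.2.integral_prod_left.const_mul C) ?_ ?_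
      · exact (hm.pow_const 2).norm.stronglyMeasurable.integral_prod_right.aestronglyMeasurable
      · filter_upwards [hf.slice] with z hz
        rw [Real.norm_of_nonneg (integral_nonneg fun _ => norm_nonneg _)]
        simp_rw [Real.norm_of_nonneg (sq_nonneg _)]
        exact h.bd _ hz
  refine ⟨⟨hm, hi⟩, ?_⟩
  rw [integral_prod _ hi, integral_prod _ hf.2, ← integral_const_mul]
  refine integral_mono_ae hi.integral_prod_left (hf.2.integral_prod_left.const_mul C) ?_
  filter_upwards [hf.slice] with z hz
  exact h.bd _ hz

lemma L2.comp_e (e : X ≃ᵐ Z × Y) (he : MeasurePreserving e μ (ζ.prod m)) {F : Z × Y → ℝ} :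
    L2 μ (fun x => F (e x)) ↔ L2 (ζ.prod m) F := by
  constructor
  · intro h
    refine ⟨?_, (he.integrable_comp_emb e.measurableEmbedding).1 h.2⟩
    have := h.1.comp e.symm.measurable
    simpa [Function.comp_def] using this
  · intro h
    exact ⟨h.1.comp e.measurable, (he.integrable_comp_emb e.measurableEmbedding).2 h.2⟩


lemma par_op (e : X ≃ᵐ Z × Y) (he : MeasurePreserving e μ (ζ.prod m)) (h : Bd m k C) {f : Z → Y → ℝ} (hf : L2 μ (fun x => f (e x).1 (e x).2)) :
    L2 μ (fun x => kop m k (f (e x).1) (e x).2) ∧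
    ∫ x, (kop m k (f (e x).1) (e x).2) ^ 2 ∂μ ≤ C * ∫ x, (f (e x).1 (e x).2) ^ 2 ∂μ := by
  have hf' := (L2.comp_e e he (F := fun p => f p.1 p.2)).1 hf
  obtain ⟨h1, h2⟩ := par_op0 h hf'
  refine ⟨(L2.comp_e e he (F := fun p => kop m k (f p.1) p.2)).2 h1, ?_⟩
  rw [← he.integral_comp' (fun p => (kop m k (f p.1) p.2) ^ 2),
    ← he.integral_comp' (fun p => (f p.1 p.2) ^ 2)] at h2
  exact h2

lemma par_lin (e : X ≃ᵐ Z × Y) (he : MeasurePreserving e μ (ζ.prod m)) (h : Bd m k C) (a : ℝ) {f g : Z → Y → ℝ} (hf : L2 μ (fun x => f (e x).1 (e x).2))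
    (hg : L2 μ (fun x => g (e x).1 (e x).2)) :
    ∀ᵐ x ∂μ, kop m k (fun y => f (e x).1 y + a * g (e x).1 y) (e x).2
      = kop m k (f (e x).1) (e x).2 + a * kop m k (g (e x).1) (e x).2 := by
  have hf' := (L2.comp_e e he (F := fun p => f p.1 p.2)).1 hf
  have hg' := (L2.comp_e e he (F := fun p => g p.1 p.2)).1 hg
  have hr : ∀ᵐ p ∂(ζ.prod m), L2 m (k p.2) := 
    Measure.quasiMeasurePreserving_snd.ae (row_L2 h.meas h.int)
  have h1 : ∀ᵐ p ∂(ζ.prod m), L2 m (f p.1) := Measure.quasiMeasurePreserving_fst.ae hf'.slice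
  have h2 : ∀ᵐ p ∂(ζ.prod m), L2 m (g p.1) := Measure.quasiMeasurePreserving_fst.ae hg'.slice
  filter_upwards [he.quasiMeasurePreserving.ae hr, he.quasiMeasurePreserving.ae h1,
    he.quasiMeasurePreserving.ae h2] with x hr h1 h2
  unfold kop
  rw [← integral_const_mul, ← integral_add (hr.int_mul h1) ((hr.int_mul h2).const_mul a)]
  congr 1; ext y; ring

lemma par_congr (e : X ≃ᵐ Z × Y) (he : MeasurePreserving e μ (ζ.prod m)) {f g : Z → Y → ℝ} 
    (hfg : ∀ᵐ x ∂μ, f (e x).1 (e x).2 = g (e x).1 (e x).2) :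
    ∀ᵐ x ∂μ, kop m k (f (e x).1) (e x).2 = kop m k (g (e x).1) (e x).2 := by
  have h0 : ∀ᵐ p ∂(ζ.prod m), f p.1 p.2 = g p.1 p.2 := by
    have hs : MeasurePreserving e.symm (ζ.prod m) μ := he.symm e
    have := hs.quasiMeasurePreserving.ae hfg
    simpa using this
  have h1 : ∀ᵐ z ∂ζ, ∀ᵐ y ∂m, f z y = g z y := Measure.ae_ae_of_ae_prod h0
  have h2 : ∀ᵐ p ∂(ζ.prod m), ∀ᵐ y ∂m, f p.1 y = g p.1 y :=
    Measure.quasiMeasurePreserving_fst.ae h1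
  filter_upwards [he.quasiMeasurePreserving.ae h2] with x hx
  unfold kop
  apply integral_congr_ae
  filter_upwards [hx] with y hy
  rw [hy]

lemma par_adj (e : X ≃ᵐ Z × Y) (he : MeasurePreserving e μ (ζ.prod m)) (h : Bd m k C) {f g : Z → Y → ℝ} (hf : L2 μ (fun x => f (e x).1 (e x).2))
    (hg : L2 μ (fun x => g (e x).1 (e x).2)) :
    ∫ x, g (e x).1 (e x).2 * kop m k (f (e x).1) (e x).2 ∂μ
      = ∫ x, kop m (fun a b => k b a) (g (e x).1) (e x).2 * f (e x).1 (e x).2 ∂μ := by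
  have hf' := (L2.comp_e e he (F := fun p => f p.1 p.2)).1 hf
  have hg' := (L2.comp_e e he (F := fun p => g p.1 p.2)).1 hg
  rw [he.integral_comp' (fun p => g p.1 p.2 * kop m k (f p.1) p.2),
    he.integral_comp' (fun p => kop m (fun a b => k b a) (g p.1) p.2 * f p.1 p.2),
    integral_prod _ (hg'.int_mul (par_op0 h hf').1),
    integral_prod _ ((par_op0 h.swap hg').1.int_mul hf')]
  apply integral_congr_ae
  filter_upwards [hf'.slice, hg'.slice] with z h1 h2
  exact kop_adj h h1 h2

end kopsec

/-! ### Cut norm -/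

def rho : Measure ℝ := volume.restrict (Icc (0:ℝ) 1)

instance : IsProbabilityMeasure rho := ⟨by simp [rho]⟩

def nuT (T : ℝ) : Measure ℝ := volume.restrict (Icc (0:ℝ) T)

instance (T : ℝ) : IsFiniteMeasure (nuT T) := by unfold nuT; infer_instance

section cutsec
variable {U : ℝ → ℝ → ℝ}

lemma int_bdd2 {X : Type*} [MeasurableSpace X] {μ : Measure X} [IsFiniteMeasure μ] {f : X → ℝ}
    (hm : Measurable f) (C : ℝ) (h : ∀ x, |f x| ≤ C) : Integrable f μ :=
  Integrable.of_bound hm.aestronglyMeasurable C (Eventually.of_forall h)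

lemma abs_int_le_one {X : Type*} [MeasurableSpace X] {μ : Measure X} [IsFiniteMeasure μ]
    (hμ : μ.real univ ≤ 1) {f : X → ℝ} (h : ∀ x, |f x| ≤ 1) : |∫ x, f x ∂μ| ≤ 1 := by
  have := norm_integral_le_of_norm_le_const (μ := μ) (f := f) (C := 1) (Eventually.of_forall h)
  rw [Real.norm_eq_abs] at this
  linarith

lemma rho_restrict_real (S : Set ℝ) : (rho.restrict S).real univ ≤ 1 := by
  rw [measureReal_restrict_apply_univ]
  exact measureReal_le_one

lemma cut_le (hU : ∀ u v, |U u v| ≤ 1) {S₁ S₂ : Set ℝ} (h1 : MeasurableSet S₁)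
    (h2 : MeasurableSet S₂) : |∫ u in S₁, ∫ v in S₂, U u v ∂rho ∂rho| ≤ cutNorm U := by
  unfold cutNorm
  apply le_csSup
  · refine ⟨1, ?_⟩
    rintro x ⟨A, B, hA, hB, hA1, hB1, rfl⟩
    have eA : volume.restrict A = rho.restrict A := by
      rw [rho, Measure.restrict_restrict hA, inter_eq_left.2 hA1]
    have eB : volume.restrict B = rho.restrict B := by
      rw [rho, Measure.restrict_restrict hB, inter_eq_left.2 hB1]
    rw [eA, eB]
    exact abs_int_le_one (rho_restrict_real A) fun u => abs_int_le_one (rho_restrict_real B) (hU u)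
  · refine ⟨S₁ ∩ Icc 0 1, S₂ ∩ Icc 0 1, h1.inter measurableSet_Icc, h2.inter measurableSet_Icc,
      inter_subset_right, inter_subset_right, ?_⟩
    simp only [rho, Measure.restrict_restrict h1, Measure.restrict_restrict h2]

lemma cut_nonneg (hU : ∀ u v, |U u v| ≤ 1) : 0 ≤ cutNorm U :=
  (abs_nonneg _).trans (cut_le hU MeasurableSet.empty MeasurableSet.empty)

lemma int_mul_le_of_sets {X : Type*} [MeasurableSpace X] {μ : Measure X} {f F : X → ℝ}
    (hf : ∀ x, |f x| ≤ 1) (hfm : Measurable f) (hF : Measurable F) (hFi : Integrable F μ) {C : ℝ}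
    (h : ∀ S, MeasurableSet S → |∫ x in S, F x ∂μ| ≤ C) : |∫ x, f x * F x ∂μ| ≤ 2 * C := by
  have hS : MeasurableSet {x | 0 ≤ F x} := measurableSet_le measurable_const hF
  have h1 : |∫ x, f x * F x ∂μ| ≤ ∫ x, |F x| ∂μ := by
    refine (abs_integral_le_integral_abs).trans ?_
    refine integral_mono_of_nonneg (Eventually.of_forall fun x => abs_nonneg _) hFi.abs
      (Eventually.of_forall fun x => ?_)
    simp only [abs_mul]
    nlinarith [hf x, abs_nonneg (F x)]
  rw [← integral_add_compl hS hFi.abs] at h1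
  have h2 : ∫ x in {x | 0 ≤ F x}, |F x| ∂μ = ∫ x in {x | 0 ≤ F x}, F x ∂μ :=
    setIntegral_congr_fun hS fun x hx => abs_of_nonneg hx
  have h3 : ∫ x in {x | 0 ≤ F x}ᶜ, |F x| ∂μ = - ∫ x in {x | 0 ≤ F x}ᶜ, F x ∂μ := by
    rw [← integral_neg]
    refine setIntegral_congr_fun hS.compl fun x hx => ?_
    simp only [mem_compl_iff, mem_setOf_eq, not_le] at hx
    exact abs_of_neg hx
  have h4 := abs_le.1 (h _ hS)
  have h5 := abs_le.1 (h _ hS.compl)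
  linarith [h4.2, h5.1]

lemma meas_kopT {U : ℝ → ℝ → ℝ} (hm : Measurable (Function.uncurry U)) {μ : Measure ℝ} [SFinite μ] :
    Measurable (fun v => ∫ u, U u v ∂μ) := by
  have : StronglyMeasurable (Function.uncurry fun v u => U u v) :=
    (hm.comp measurable_swap).stronglyMeasurable
  exact this.integral_prod_right.measurable

lemma cut_bilin (hm : Measurable (Function.uncurry U)) (hU : ∀ u v, |U u v| ≤ 1) {f g : ℝ → ℝ}
    (hfm : Measurable f) (hgm : Measurable g) (hf : ∀ x, |f x| ≤ 1) (hg : ∀ x, |g x| ≤ 1) :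
    |∫ u, f u * ∫ v, g v * U u v ∂rho ∂rho| ≤ 4 * cutNorm U := by
  have hgU : Measurable (Function.uncurry fun u v => g v * U u v) :=
    (hgm.comp measurable_snd).mul hm
  have hgUb : ∀ u v, |g v * U u v| ≤ 1 := fun u v => by
    rw [abs_mul]; exact mul_le_one₀ (hg v) (abs_nonneg _) (hU u v)
  have hr : rho.real univ ≤ 1 := measureReal_le_one
  have := int_mul_le_of_sets (μ := rho) (f := f) (F := fun u => ∫ v, g v * U u v ∂rho)
    (C := 2 * cutNorm U) hf hfm
    hgU.stronglyMeasurable.integral_prod_right.measurable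
    (int_bdd2 hgU.stronglyMeasurable.integral_prod_right.measurable 1
      fun u => abs_int_le_one hr (hgUb u)) ?_
  · linarith
  intro S hS
  rw [integral_integral_swap (f := fun u v => g v * U u v) (int_bdd2 hgU 1 fun p => hgUb p.1 p.2)]
  simp_rw [integral_const_mul]
  refine int_mul_le_of_sets hg hgm (meas_kopT hm) (int_bdd2 (meas_kopT hm) 1
    fun v => abs_int_le_one (rho_restrict_real S) fun u => hU u v) ?_
  intro S2 hS2
  rw [integral_integral_swap (f := fun v u => U u v)
    (int_bdd2 (hm.comp measurable_swap) 1 fun p => hU p.2 p.1)]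
  exact cut_le hU hS hS2

lemma Bd.of_bdd (hm : Measurable (Function.uncurry U)) (hU : ∀ u v, |U u v| ≤ 1) :
    ∃ C, Bd rho U C :=
  ⟨_, Bd.of_int hm (int_bdd2 (hm.pow_const 2) 1 fun p => by
    rw [abs_pow]; exact pow_le_one₀ (abs_nonneg _) (hU p.1 p.2))⟩

lemma cut_op (hm : Measurable (Function.uncurry U)) (hU : ∀ u v, |U u v| ≤ 1)
    (hs : ∀ u v, U u v = U v u) : Bd rho U (2 * Real.sqrt (cutNorm U)) := by
  obtain ⟨C, hC⟩ := Bd.of_bdd hm hU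
  refine ⟨hC.meas, hC.int, by positivity, fun g hg => ?_⟩
  have hr : rho.real univ ≤ 1 := measureReal_le_one
  set h : ℝ → ℝ → ℝ := fun v v' => ∫ u, U v u * U u v' ∂rho with hh
  have hprod : Measurable (fun q : (ℝ × ℝ) × ℝ => U q.1.1 q.2 * U q.2 q.1.2) := by
    apply Measurable.mul
    · exact hm.comp ((measurable_fst.comp measurable_fst).prodMk measurable_snd)
    · exact hm.comp (measurable_snd.prodMk (measurable_snd.comp measurable_fst))
  have hhm : Measurable (Function.uncurry h) :=
    (StronglyMeasurable.integral_prod_right (f := fun (p : ℝ × ℝ) u => U p.1 u * U u p.2)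
      hprod.stronglyMeasurable).measurable
  have hb2 : ∀ a b c d, |U a b * U c d| ≤ 1 := fun a b c d => by
    rw [abs_mul]; exact mul_le_one₀ (hU a b) (abs_nonneg _) (hU c d)
  have hhb : ∀ u v, |h u v| ≤ 1 := fun u v => abs_int_le_one hr fun x => hb2 _ _ _ _
  have hhi : Integrable (fun p : ℝ × ℝ => (h p.1 p.2) ^ 2) (rho.prod rho) :=
    (int_bdd2 (hhm.pow_const 2) 1 fun p => by
      rw [abs_pow]; exact pow_le_one₀ (abs_nonneg _) (hhb p.1 p.2))
  have hhB := Bd.of_int hhm hhi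
  -- Hilbert-Schmidt norm of `h`
  have hHS : ∫ p, (h p.1 p.2) ^ 2 ∂(rho.prod rho) ≤ 4 * cutNorm U := by
    rw [integral_prod_symm _ hhi]
    have hin : ∀ v', ∫ v, (h v v') ^ 2 ∂rho ≤ 4 * cutNorm U := by
      intro v'
      have e1 : ∫ v, (h v v') ^ 2 ∂rho = ∫ v, ∫ u, h v v' * (U v u * U u v') ∂rho ∂rho := by
        congr 1; ext v; rw [integral_const_mul, sq]
      have hhv : Measurable fun v => h v v' := hhm.comp measurable_prodMk_right
      have hUv : Measurable fun u => U u v' := hm.comp measurable_prodMk_right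
      rw [e1, integral_integral_swap (f := fun v u => h v v' * (U v u * U u v'))
        (int_bdd2 ((hhv.comp measurable_fst).mul (hm.mul (hUv.comp measurable_snd))) 1 fun p => by
          simp only [Function.uncurry]
          rw [abs_mul]; exact mul_le_one₀ (hhb _ _) (abs_nonneg _) (hb2 _ _ _ _))]
      have e2 : ∫ u, ∫ v, h v v' * (U v u * U u v') ∂rho ∂rho
          = ∫ u, U u v' * ∫ v, h v v' * U u v ∂rho ∂rho := by
        congr 1; ext u; rw [← integral_const_mul]; congr 1; ext v; rw [hs v u]; ring
      rw [e2]
      exact (le_abs_self _).trans (cut_bilin hm hU hUv hhv (fun u => hU u v') fun v => hhb v v')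
    calc _ ≤ ∫ v', 4 * cutNorm U ∂rho := integral_mono hhi.integral_prod_right (integrable_const _) hin
      _ = _ := by simp
  -- U U g = h g
  have hUU : kop rho U (kop rho U g) = kop rho h g := by
    ext x
    unfold kop
    have hg1 : Integrable g rho := by
      have := hg.int_mul (L2.of_bdd (μ := rho) (f := fun _ => (1:ℝ)) measurable_const 1 (by simp))
      simpa using this
    have hi : Integrable (Function.uncurry fun u v => U x u * (U u v * g v)) (rho.prod rho) := by
      have hgp : Integrable (fun p : ℝ × ℝ => g p.2) (rho.prod rho) := hg1.comp_snd rho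
      have hx : Measurable fun u => U x u := hm.comp measurable_prodMk_left
      refine Integrable.mono' hgp.abs (((hx.comp measurable_fst).mul
        (hm.mul (hg.1.comp measurable_snd))).aestronglyMeasurable) (Eventually.of_forall fun p => ?_)
      simp only [Function.uncurry, Real.norm_eq_abs]
      rw [← mul_assoc, abs_mul]
      exact mul_le_of_le_one_left (abs_nonneg _) (hb2 _ _ _ _)
    have e1 : ∫ u, U x u * ∫ v, U u v * g v ∂rho ∂rho
        = ∫ u, ∫ v, U x u * (U u v * g v) ∂rho ∂rho := by
      congr 1; ext u; rw [integral_const_mul]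
    rw [e1, integral_integral_swap hi]
    congr 1; ext v; rw [hh, ← integral_mul_const]; congr 1; ext u; ring
  have e3 : ∫ x, (kop rho U g x) ^ 2 ∂rho = ∫ x, kop rho h g x * g x ∂rho := by
    have h1 := kop_adj hC hg (hC.L2 hg)
    have h2 : (fun a b => U b a) = U := by ext a b; exact hs b a
    rw [h2, hUU] at h1
    rw [← h1]
    congr 1; ext x; ring
  have h5 := (hhB.L2 hg).cs hg
  have h6 := hhB.bd g hg
  have hg0 : 0 ≤ ∫ x, (g x) ^ 2 ∂rho := L2.sq_nonneg_int
  have hc0 := cut_nonneg hU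
  rw [e3]
  refine (le_abs_self _).trans (abs_le_of_sq_le_sq ?_ (by positivity))
  calc (∫ x, kop rho h g x * g x ∂rho) ^ 2
      ≤ (4 * cutNorm U * ∫ x, (g x) ^ 2 ∂rho) * ∫ x, (g x) ^ 2 ∂rho := by
        refine h5.trans (mul_le_mul_of_nonneg_right (h6.trans ?_) hg0)
        exact mul_le_mul_of_nonneg_right hHS hg0
    _ = (2 * Real.sqrt (cutNorm U) * ∫ x, (g x) ^ 2 ∂rho) ^ 2 := by
        rw [mul_pow, mul_pow, Real.sq_sqrt hc0]; ring

end cutsec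

/-! ### Step functions -/

def idx (N : ℕ) (hN : 0 < N) (u : ℝ) : Fin N :=
  ⟨stepIdx N u, by unfold stepIdx; omega⟩

lemma stepOf_eq {X : Type*} (x₀ : X) (N : ℕ) (hN : 0 < N) (g : Fin N → X) (u : ℝ) :
    stepOf x₀ N g u = g (idx N hN u) := by
  unfold stepOf
  exact dif_pos (idx N hN u).2

lemma stepW_eq (N : ℕ) (hN : 0 < N) (w : Fin N → Fin N → ℝ) (u v : ℝ) :
    stepW N w u v = w (idx N hN u) (idx N hN v) := by
  unfold stepW
  rw [stepOf_eq 0 N hN, stepOf_eq 0 N hN]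

lemma idx_meas (N : ℕ) (hN : 0 < N) : Measurable (idx N hN) := by
  have h : Measurable (stepIdx N) := by
    unfold stepIdx
    exact (Nat.measurable_floor.comp (measurable_id.mul_const _)).min measurable_const
  refine measurable_to_countable' fun i => ?_
  have : idx N hN ⁻¹' {i} = stepIdx N ⁻¹' {i.1} := by
    ext u; simp [idx, Fin.ext_iff]
  rw [this]
  exact h (measurableSet_singleton _)

lemma idx_measure (N : ℕ) (hN : 0 < N) (i : Fin N) : rho.real (idx N hN ⁻¹' {i}) = 1 / (N:ℝ) := by
  have hN' : (0:ℝ) < N := by exact_mod_cast hN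
  have h1 : rho = volume.restrict (Ico (0:ℝ) 1) := (Measure.restrict_congr_set Ico_ae_eq_Icc).symm
  have hset : idx N hN ⁻¹' {i} ∩ Ico (0:ℝ) 1 = Ico ((i:ℝ) / N) (((i:ℝ) + 1) / N) := by
    ext u
    simp only [mem_inter_iff, mem_preimage, mem_singleton_iff, mem_Ico, Fin.ext_iff, idx]
    rw [div_le_iff₀ hN', lt_div_iff₀ hN']
    have hi : ((i:ℕ):ℝ) + 1 ≤ N := by exact_mod_cast i.2
    constructor
    · rintro ⟨h, h0, hu⟩
      have hlt : ⌊u * (N:ℝ)⌋₊ < N := by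
        rw [Nat.floor_lt (by positivity)]
        nlinarith
      have : ⌊u * (N:ℝ)⌋₊ = i := by
        unfold stepIdx at h; omega
      exact (Nat.floor_eq_iff (by positivity)).1 this
    · rintro ⟨h, h'⟩
      have h0 : 0 ≤ u := by
        by_contra hneg
        push Not at hneg
        have : u * N < 0 := mul_neg_of_neg_of_pos hneg hN'
        have : (0:ℝ) ≤ (i:ℕ) := Nat.cast_nonneg _
        linarith
      refine ⟨?_, h0, ?_⟩
      · have := (Nat.floor_eq_iff (by positivity : 0 ≤ u * (N:ℝ))).2 ⟨h, h'⟩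
        unfold stepIdx
        omega
      · by_contra hge
        push Not at hge
        nlinarith
  rw [h1, measureReal_restrict_apply (idx_meas N hN (measurableSet_singleton i)), hset,
    Real.volume_real_Ico_of_le (by gcongr; linarith)]
  ring

lemma idx_int (N : ℕ) (hN : 0 < N) (φ : Fin N → ℝ) :
    ∫ u, φ (idx N hN u) ∂rho = (1 / (N:ℝ)) * ∑ i, φ i := by
  have : ∀ u, φ (idx N hN u) = ∑ i, (idx N hN ⁻¹' {i}).indicator (fun _ => φ i) u := by
    intro u
    rw [Finset.sum_eq_single (idx N hN u)]
    · simp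
    · intro i _ hi
      simp [hi.symm]
    · simp
  rw [integral_congr_ae (Eventually.of_forall this), integral_finsetSum]
  · rw [Finset.mul_sum]
    refine Finset.sum_congr rfl fun i _ => ?_
    rw [integral_indicator_const _ (idx_meas N hN (measurableSet_singleton i)), idx_measure,
      smul_eq_mul]
  · intro i _
    exact (integrable_const _).indicator (idx_meas N hN (measurableSet_singleton i))


/-! ### Two- and three-variable setting -/

lemma iadd {X : Type*} [MeasurableSpace X] {μ : Measure X} {f g : X → ℝ} (hf : Integrable f μ)
    (hg : Integrable g μ) : Integrable (fun x => f x + g x) μ := hf.add hg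

section setsec
variable {mΩ : MeasurableSpace Ω} {P : Measure Ω} [IsProbabilityMeasure P] {T : ℝ}

lemma prog_meas {F : Filtration ℝ mΩ} {α : ℝ → Ω → ℝ} (h : ProgMeasurable F α) :
    Measurable (fun p : ℝ × Ω => α p.1 p.2) := by
  have hn : ∀ n : ℕ, Measurable (fun p : ℝ × Ω => α (min p.1 n) p.2) := by
    intro n
    have h1 : Measurable (fun q : Iic (n:ℝ) × Ω => α q.1 q.2) :=
      (h n).measurable.mono (sup_le_sup le_rfl (MeasurableSpace.comap_mono (F.le n))) le_rfl
    have h2 : Measurable (fun p : ℝ × Ω => ((⟨min p.1 n, mem_Iic.2 (min_le_right _ _)⟩ : Iic (n:ℝ)), p.2)) :=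
      ((measurable_fst.min measurable_const).subtype_mk).prodMk measurable_snd
    exact h1.comp h2
  refine measurable_of_tendsto_metrizable hn ?_
  rw [tendsto_pi_nhds]
  intro p
  obtain ⟨n, hn⟩ := exists_nat_ge p.1
  refine tendsto_const_nhds.congr' ?_
  filter_upwards [eventually_ge_atTop n] with k hk
  have : p.1 ≤ (k:ℝ) := hn.trans (by exact_mod_cast hk)
  rw [min_eq_left this]

def tau (T : ℝ) (P : Measure Ω) : Measure (ℝ × Ω) := (nuT T).prod P

def mu3 (T : ℝ) (P : Measure Ω) : Measure (ℝ × ℝ × Ω) := rho.prod (tau T P)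

instance : IsFiniteMeasure (tau T P) := by unfold tau; infer_instance
instance : IsFiniteMeasure (mu3 T P) := by unfold mu3; infer_instance

lemma adm_L2 {F : Filtration ℝ mΩ} {α : ℝ → Ω → ℝ} (h : Admissible T F P α) :
    L2 (tau T P) (fun p => α p.1 p.2) := ⟨prog_meas h.1, h.2⟩

def e0 : ℝ × Ω ≃ᵐ Ω × ℝ := MeasurableEquiv.prodComm

lemma he0 : MeasurePreserving (e0 (Ω := Ω) (mΩ := mΩ)) (tau T P) (P.prod (nuT T)) :=
  Measure.measurePreserving_swap

def e1 : ℝ × ℝ × Ω ≃ᵐ (ℝ × Ω) × ℝ :=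
  (MeasurableEquiv.prodCongr (MeasurableEquiv.refl ℝ) MeasurableEquiv.prodComm).trans
    MeasurableEquiv.prodAssoc.symm

lemma he1 : MeasurePreserving (e1 (Ω := Ω) (mΩ := mΩ)) (mu3 T P) ((rho.prod P).prod (nuT T)) := by
  have h1 : MeasurePreserving (Prod.map id Prod.swap : ℝ × ℝ × Ω → ℝ × Ω × ℝ)
      (mu3 T P) (rho.prod (P.prod (nuT T))) :=
    (MeasurePreserving.id rho).prod Measure.measurePreserving_swap
  have h2 := (measurePreserving_prodAssoc rho P (nuT T)).symm MeasurableEquiv.prodAssoc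
  exact h2.comp h1

def e2 : ℝ × ℝ × Ω ≃ᵐ (ℝ × Ω) × ℝ := MeasurableEquiv.prodComm

lemma he2 : MeasurePreserving (e2 (Ω := Ω) (mΩ := mΩ)) (mu3 T P) ((tau T P).prod rho) :=
  Measure.measurePreserving_swap

def e3 : ℝ × ℝ × Ω ≃ᵐ Ω × ℝ × ℝ := MeasurableEquiv.prodAssoc.symm.trans MeasurableEquiv.prodComm

lemma he3 : MeasurePreserving (e3 (Ω := Ω) (mΩ := mΩ)) (mu3 T P) (P.prod (rho.prod (nuT T))) := by
  have h2 := (measurePreserving_prodAssoc rho (nuT T) P).symm MeasurableEquiv.prodAssoc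
  exact Measure.measurePreserving_swap.comp h2

def L3 (T : ℝ) (P : Measure Ω) (f : ℝ → ℝ → Ω → ℝ) : Prop :=
  L2 (mu3 T P) (fun q => f q.1 q.2.1 q.2.2)

def opT (T : ℝ) (k : ℝ → ℝ → ℝ) (f : ℝ → ℝ → Ω → ℝ) : ℝ → ℝ → Ω → ℝ :=
  fun u t ω => kop (nuT T) k (fun s => f u s ω) t

def opU (V : ℝ → ℝ → ℝ) (f : ℝ → ℝ → Ω → ℝ) : ℝ → ℝ → Ω → ℝ :=
  fun u t ω => kop rho V (fun v => f v t ω) u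

variable {k V : ℝ → ℝ → ℝ} {C : ℝ} {f g : ℝ → ℝ → Ω → ℝ}

lemma opT_L3 (h : Bd (nuT T) k C) (hf : L3 T P f) : L3 T P (opT T k f) ∧
    ∫ q, (opT T k f q.1 q.2.1 q.2.2) ^ 2 ∂(mu3 T P) ≤ C * ∫ q, (f q.1 q.2.1 q.2.2) ^ 2 ∂(mu3 T P) :=
  par_op e1 he1 h (f := fun z s => f z.1 s z.2) hf

lemma opU_L3 (h : Bd rho V C) (hf : L3 T P f) : L3 T P (opU V f) ∧
    ∫ q, (opU V f q.1 q.2.1 q.2.2) ^ 2 ∂(mu3 T P) ≤ C * ∫ q, (f q.1 q.2.1 q.2.2) ^ 2 ∂(mu3 T P) :=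
  par_op e2 he2 h (f := fun z v => f v z.1 z.2) hf

lemma opT_lin (h : Bd (nuT T) k C) (a : ℝ) (hf : L3 T P f) (hg : L3 T P g) :
    ∀ᵐ q ∂(mu3 T P), opT T k (fun u t ω => f u t ω + a * g u t ω) q.1 q.2.1 q.2.2
      = opT T k f q.1 q.2.1 q.2.2 + a * opT T k g q.1 q.2.1 q.2.2 :=
  par_lin e1 he1 h a (f := fun z s => f z.1 s z.2) (g := fun z s => g z.1 s z.2) hf hg

lemma opU_lin (h : Bd rho V C) (a : ℝ) (hf : L3 T P f) (hg : L3 T P g) :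
    ∀ᵐ q ∂(mu3 T P), opU V (fun u t ω => f u t ω + a * g u t ω) q.1 q.2.1 q.2.2
      = opU V f q.1 q.2.1 q.2.2 + a * opU V g q.1 q.2.1 q.2.2 :=
  par_lin e2 he2 h a (f := fun z s => f s z.1 z.2) (g := fun z s => g s z.1 z.2) hf hg

lemma opU_congr (h : ∀ᵐ q ∂(mu3 T P), f q.1 q.2.1 q.2.2 = g q.1 q.2.1 q.2.2) :
    ∀ᵐ q ∂(mu3 T P), opU V f q.1 q.2.1 q.2.2 = opU V g q.1 q.2.1 q.2.2 :=
  par_congr e2 he2 (f := fun z s => f s z.1 z.2) (g := fun z s => g s z.1 z.2) h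

lemma opT_adj (h : Bd (nuT T) k C) (hf : L3 T P f) (hg : L3 T P g) :
    ∫ q, g q.1 q.2.1 q.2.2 * opT T k f q.1 q.2.1 q.2.2 ∂(mu3 T P)
    = ∫ q, opT T (fun a b => k b a) g q.1 q.2.1 q.2.2 * f q.1 q.2.1 q.2.2 ∂(mu3 T P) :=
  par_adj e1 he1 h (f := fun z s => f z.1 s z.2) (g := fun z s => g z.1 s z.2) hf hg

lemma opU_adj (h : Bd rho V C) (hf : L3 T P f) (hg : L3 T P g) :
    ∫ q, g q.1 q.2.1 q.2.2 * opU V f q.1 q.2.1 q.2.2 ∂(mu3 T P)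
    = ∫ q, opU (fun a b => V b a) g q.1 q.2.1 q.2.2 * f q.1 q.2.1 q.2.2 ∂(mu3 T P) :=
  par_adj e2 he2 h (f := fun z s => f s z.1 z.2) (g := fun z s => g s z.1 z.2) hf hg

lemma L3.slice_u (hf : L3 T P f) : ∀ᵐ u ∂rho, L2 (tau T P) (fun p => f u p.1 p.2) :=
  L2.slice (f := fun (u : ℝ) (p : ℝ × Ω) => f u p.1 p.2) hf

lemma L3.slice_ω (hf : L3 T P f) :
    ∀ᵐ ω ∂P, L2 (rho.prod (nuT T)) (fun p => f p.1 p.2 ω) :=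
  L2.slice (f := fun (ω : Ω) (p : ℝ × ℝ) => f p.1 p.2 ω)
    ((L2.comp_e e3 he3 (F := fun z => f z.2.1 z.2.2 z.1)).1 hf)

lemma comm_path {D : ℝ → ℝ → ℝ} (hD : L2 (rho.prod (nuT T)) (fun p => D p.1 p.2)) {u t : ℝ}
    (hu : L2 rho (V u)) (ht : L2 (nuT T) (k t)) :
    kop (nuT T) k (fun s => kop rho V (fun v => D v s) u) t
      = kop rho V (fun v => kop (nuT T) k (fun s => D v s) t) u := by
  have h1 : L2 (rho.prod (nuT T)) (fun p => V u p.1 * k t p.2) := by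
    refine ⟨(hu.1.comp measurable_fst).mul (ht.1.comp measurable_snd), ?_⟩
    simp_rw [mul_pow]
    exact hu.2.mul_prod ht.2
  have h2 := integral_integral_swap (f := fun v s => V u v * k t s * D v s) (h1.int_mul hD)
  unfold kop
  calc _ = ∫ s, ∫ v, V u v * k t s * D v s ∂rho ∂(nuT T) := by
        congr 1; ext s; rw [← integral_const_mul]; congr 1; ext v; ring
    _ = _ := h2.symm
    _ = _ := by
        congr 1; ext s; rw [← integral_const_mul]; congr 1; ext v; ring

lemma comm3 {C' : ℝ} (hk : Bd (nuT T) k C) (hV : Bd rho V C') (hf : L3 T P f) :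
    ∀ᵐ q ∂(mu3 T P), opT T k (opU V f) q.1 q.2.1 q.2.2 = opU V (opT T k f) q.1 q.2.1 q.2.2 := by
  have hu : ∀ᵐ q ∂(mu3 T P), L2 rho (V q.1) :=
    Measure.quasiMeasurePreserving_fst.ae (row_L2 hV.meas hV.int)
  have ht : ∀ᵐ q ∂(mu3 T P), L2 (nuT T) (k q.2.1) :=
    Measure.quasiMeasurePreserving_snd.ae
      ((Measure.quasiMeasurePreserving_fst (μ := nuT T) (ν := P)).ae (row_L2 hk.meas hk.int))
  have hω : ∀ᵐ q ∂(mu3 T P), L2 (rho.prod (nuT T)) (fun p => f p.1 p.2 q.2.2) :=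
    Measure.quasiMeasurePreserving_snd.ae
      ((Measure.quasiMeasurePreserving_snd (μ := nuT T) (ν := P)).ae hf.slice_ω)
  filter_upwards [hu, ht, hω] with q hu ht hω
  exact comm_path (D := fun v s => f v s q.2.2) hω hu ht

lemma int3 {F : ℝ → ℝ → Ω → ℝ} (hF : Integrable (fun q : ℝ × ℝ × Ω => F q.1 q.2.1 q.2.2) (mu3 T P)) :
    Integrable (fun ω => ∫ u, ∫ t, F u t ω ∂(nuT T) ∂rho) P ∧
    ∫ q, F q.1 q.2.1 q.2.2 ∂(mu3 T P) = ∫ ω, ∫ u, ∫ t, F u t ω ∂(nuT T) ∂rho ∂P := by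
  have h1 : Integrable (fun z : Ω × ℝ × ℝ => F z.2.1 z.2.2 z.1) (P.prod (rho.prod (nuT T))) :=
    (he3.integrable_comp_emb e3.measurableEmbedding).1 hF
  have h2 : ∫ q, F q.1 q.2.1 q.2.2 ∂(mu3 T P)
      = ∫ z, F z.2.1 z.2.2 z.1 ∂(P.prod (rho.prod (nuT T))) :=
    he3.integral_comp' (fun z : Ω × ℝ × ℝ => F z.2.1 z.2.2 z.1)
  have h3 : ∀ᵐ ω ∂P, ∫ p, F p.1 p.2 ω ∂(rho.prod (nuT T)) = ∫ u, ∫ t, F u t ω ∂(nuT T) ∂rho := by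
    filter_upwards [h1.prod_right_ae] with ω hω
    exact integral_prod _ hω
  refine ⟨h1.integral_prod_left.congr h3, ?_⟩
  rw [h2, integral_prod _ h1]
  exact integral_congr_ae h3

/-- the first-order operator -/
def Lop (T lam : ℝ) (A B V : ℝ → ℝ → ℝ) (f : ℝ → ℝ → Ω → ℝ) : ℝ → ℝ → Ω → ℝ :=
  fun u t ω => 2 * lam * f u t ω + opT T A f u t ω + opT T (fun a b => A b a) f u t ω
    + opU V (opT T B f) u t ω + opU V (opT T (fun a b => B b a) f) u t ω

lemma energy {A B : ℝ → ℝ → ℝ} {CA CB CV lam κ : ℝ} (hA : Bd (nuT T) A CA) (hB : Bd (nuT T) B CB)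
    (hV : Bd rho V CV) (hs : ∀ u v, V u v = V v u) (hκ : 0 < κ)
    {D r : ℝ → ℝ → Ω → ℝ} (hD : L3 T P D) (hr : L3 T P r)
    (h0 : ∫ q, D q.1 q.2.1 q.2.2 * (Lop T lam A B V D q.1 q.2.1 q.2.2 - r q.1 q.2.1 q.2.2)
      ∂(mu3 T P) = 0)
    (hco : ∀ᵐ ω ∂P, κ * ∫ u, ∫ t, (D u t ω) ^ 2 ∂(nuT T) ∂rho ≤
      ∫ u, ∫ t, D u t ω * (lam * D u t ω + opT T A D u t ω + opU V (opT T B D) u t ω)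
        ∂(nuT T) ∂rho) :
    4 * κ ^ 2 * ∫ q, (D q.1 q.2.1 q.2.2) ^ 2 ∂(mu3 T P) ≤ ∫ q, (r q.1 q.2.1 q.2.2) ^ 2 ∂(mu3 T P) := by
  have hAD := (opT_L3 hA hD).1
  have hA'D := (opT_L3 hA.swap hD).1
  have hBD := (opT_L3 hB hD).1
  have hB'D := (opT_L3 hB.swap hD).1
  have hVBD := (opU_L3 hV hBD).1
  have hVB'D := (opU_L3 hV hB'D).1
  have hVD := (opU_L3 hV hD).1
  have i0 : Integrable (fun q : ℝ × ℝ × Ω => (D q.1 q.2.1 q.2.2) ^ 2) (mu3 T P) := hD.2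
  have iA := L2.int_mul hD hAD
  have iA' := L2.int_mul hD hA'D
  have iB := L2.int_mul hD hVBD
  have iB' := L2.int_mul hD hVB'D
  have ir := L2.int_mul hD hr
  have hVs : (fun a b => V b a) = V := by ext a b; exact hs b a
  -- adjointness
  have adjA : ∫ q, D q.1 q.2.1 q.2.2 * opT T (fun a b => A b a) D q.1 q.2.1 q.2.2 ∂(mu3 T P)
      = ∫ q, D q.1 q.2.1 q.2.2 * opT T A D q.1 q.2.1 q.2.2 ∂(mu3 T P) := by
    rw [opT_adj hA.swap hD hD]
    congr 1; ext q; exact mul_comm _ _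
  have adjB : ∫ q, D q.1 q.2.1 q.2.2 * opU V (opT T (fun a b => B b a) D) q.1 q.2.1 q.2.2 ∂(mu3 T P)
      = ∫ q, D q.1 q.2.1 q.2.2 * opU V (opT T B D) q.1 q.2.1 q.2.2 ∂(mu3 T P) := by
    rw [opU_adj hV hB'D hD, hVs, opT_adj hB.swap hD hVD]
    apply integral_congr_ae
    filter_upwards [comm3 hB hV hD] with q hq
    rw [← hq]; exact mul_comm _ _
  -- split
  have hint : Integrable (fun q : ℝ × ℝ × Ω => D q.1 q.2.1 q.2.2 * (lam * D q.1 q.2.1 q.2.2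
      + opT T A D q.1 q.2.1 q.2.2 + opU V (opT T B D) q.1 q.2.1 q.2.2)) (mu3 T P) :=
    L2.int_mul hD (((L2.smul lam hD).add hAD).add hVBD)
  have s1 : ∫ q, D q.1 q.2.1 q.2.2 * (lam * D q.1 q.2.1 q.2.2
      + opT T A D q.1 q.2.1 q.2.2 + opU V (opT T B D) q.1 q.2.1 q.2.2) ∂(mu3 T P)
      = lam * (∫ q, (D q.1 q.2.1 q.2.2) ^ 2 ∂(mu3 T P))
        + (∫ q, D q.1 q.2.1 q.2.2 * opT T A D q.1 q.2.1 q.2.2 ∂(mu3 T P))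
        + ∫ q, D q.1 q.2.1 q.2.2 * opU V (opT T B D) q.1 q.2.1 q.2.2 ∂(mu3 T P) := by
    rw [← integral_const_mul, ← integral_add (i0.const_mul lam) iA,
      ← integral_add (iadd (i0.const_mul lam) iA) iB]
    congr 1; ext q; ring
  have s2 : ∫ q, D q.1 q.2.1 q.2.2 * (Lop T lam A B V D q.1 q.2.1 q.2.2 - r q.1 q.2.1 q.2.2)
      ∂(mu3 T P) = 2 * lam * (∫ q, (D q.1 q.2.1 q.2.2) ^ 2 ∂(mu3 T P))
        + (∫ q, D q.1 q.2.1 q.2.2 * opT T A D q.1 q.2.1 q.2.2 ∂(mu3 T P))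
        + (∫ q, D q.1 q.2.1 q.2.2 * opT T (fun a b => A b a) D q.1 q.2.1 q.2.2 ∂(mu3 T P))
        + (∫ q, D q.1 q.2.1 q.2.2 * opU V (opT T B D) q.1 q.2.1 q.2.2 ∂(mu3 T P))
        + (∫ q, D q.1 q.2.1 q.2.2 * opU V (opT T (fun a b => B b a) D) q.1 q.2.1 q.2.2 ∂(mu3 T P))
        - ∫ q, D q.1 q.2.1 q.2.2 * r q.1 q.2.1 q.2.2 ∂(mu3 T P) := by
    have j1 := iadd (i0.const_mul (2 * lam)) iA
    have j2 := iadd j1 iA'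
    have j3 := iadd j2 iB
    have j4 := iadd j3 iB'
    rw [← integral_const_mul, ← integral_add (i0.const_mul (2 * lam)) iA,
      ← integral_add j1 iA', ← integral_add j2 iB, ← integral_add j3 iB', ← integral_sub j4 ir]
    congr 1; ext q; simp only [Lop]; ring
  have s3 : κ * (∫ q, (D q.1 q.2.1 q.2.2) ^ 2 ∂(mu3 T P)) ≤
      ∫ q, D q.1 q.2.1 q.2.2 * (lam * D q.1 q.2.1 q.2.2
      + opT T A D q.1 q.2.1 q.2.2 + opU V (opT T B D) q.1 q.2.1 q.2.2) ∂(mu3 T P) := by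
    obtain ⟨a1, a2⟩ := int3 (F := fun u t ω => (D u t ω) ^ 2) i0
    obtain ⟨b1, b2⟩ := int3 (F := fun u t ω => D u t ω * (lam * D u t ω + opT T A D u t ω
      + opU V (opT T B D) u t ω)) hint
    rw [a2, b2, ← integral_const_mul]
    exact integral_mono_ae (a1.const_mul κ) b1 hco
  have hcs := L2.cs hD hr
  have hS : 0 ≤ ∫ q, (D q.1 q.2.1 q.2.2) ^ 2 ∂(mu3 T P) := L2.sq_nonneg_int
  have hR : 0 ≤ ∫ q, (r q.1 q.2.1 q.2.2) ^ 2 ∂(mu3 T P) := L2.sq_nonneg_int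
  have hmain : 2 * κ * (∫ q, (D q.1 q.2.1 q.2.2) ^ 2 ∂(mu3 T P)) ≤
      ∫ q, D q.1 q.2.1 q.2.2 * r q.1 q.2.1 q.2.2 ∂(mu3 T P) := by
    rw [adjA, adjB, h0] at s2
    linarith
  generalize (∫ q, (D q.1 q.2.1 q.2.2) ^ 2 ∂(mu3 T P)) = S at *
  generalize (∫ q, (r q.1 q.2.1 q.2.2) ^ 2 ∂(mu3 T P)) = R at *
  generalize (∫ q, D q.1 q.2.1 q.2.2 * r q.1 q.2.1 q.2.2 ∂(mu3 T P)) = Q at *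
  rcases hS.eq_or_lt with h | h
  · rw [← h]; simpa using hR
  · have h1 : (2 * κ * S) ^ 2 ≤ S * R := (pow_le_pow_left₀ (by positivity) hmain 2).trans hcs
    have h2 : S * (4 * κ ^ 2 * S) ≤ S * R := by nlinarith
    exact le_of_mul_le_mul_left h2 h

/-! ### First-order conditions -/

lemma ip_int {f g : ℝ → Ω → ℝ} (hf : L2 (tau T P) (fun p => f p.1 p.2))
    (hg : L2 (tau T P) (fun p => g p.1 p.2)) :
    Integrable (fun ω => ip T (fun t => f t ω) (fun t => g t ω)) P ∧
    ∫ ω, ip T (fun t => f t ω) (fun t => g t ω) ∂P = ∫ p, f p.1 p.2 * g p.1 p.2 ∂(tau T P) := by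
  have h := hf.int_mul hg
  refine ⟨h.integral_prod_right, ?_⟩
  exact (integral_prod_symm _ h).symm

def op2 (T : ℝ) (k : ℝ → ℝ → ℝ) (f : ℝ → Ω → ℝ) : ℝ → Ω → ℝ :=
  fun t ω => kop (nuT T) k (fun s => f s ω) t

lemma op2_L2 {f : ℝ → Ω → ℝ} (h : Bd (nuT T) k C) (hf : L2 (tau T P) (fun p => f p.1 p.2)) :
    L2 (tau T P) (fun p => op2 T k f p.1 p.2) :=
  (par_op e0 he0 h (f := fun ω s => f s ω) hf).1

lemma foc {A : ℝ → ℝ → ℝ} {CA lam R : ℝ} (hA : Bd (nuT T) A CA) {F : Filtration ℝ mΩ}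
    {α h b δ : ℝ → Ω → ℝ}
    (hα : Admissible T F P α) (hδ : Admissible T F P δ)
    (hh : L2 (tau T P) (fun p => h p.1 p.2)) (hb : L2 (tau T P) (fun p => b p.1 p.2))
    {J : (ℝ → Ω → ℝ) → ℝ}
    (hJ : ∀ β, Admissible T F P β → J β =
      - (∫ p, β p.1 p.2 * (op2 T A β p.1 p.2 + lam * β p.1 p.2) ∂(tau T P))
      - (∫ p, β p.1 p.2 * h p.1 p.2 ∂(tau T P)) + (∫ p, b p.1 p.2 * β p.1 p.2 ∂(tau T P)) + R)
    (hopt : ∀ β, Admissible T F P β → J β ≤ J α) :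
    ∫ p, δ p.1 p.2 * (2 * lam * α p.1 p.2 + op2 T A α p.1 p.2 + op2 T (fun a b => A b a) α p.1 p.2
      + h p.1 p.2 - b p.1 p.2) ∂(tau T P) = 0 := by
  have ha := adm_L2 hα
  have hd := adm_L2 hδ
  have hAa := op2_L2 hA ha
  have hAd := op2_L2 hA hd
  have hA'a := op2_L2 hA.swap ha
  have adm : ∀ ε : ℝ, Admissible T F P (fun t ω => α t ω + ε * δ t ω) := by
    intro ε
    refine ⟨fun i => ?_, (ha.add (hd.smul ε)).2⟩
    exact (hα.1 i).add ((hδ.1 i).const_mul ε)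
  have adj : ∫ p, α p.1 p.2 * op2 T A δ p.1 p.2 ∂(tau T P)
      = ∫ p, op2 T (fun a b => A b a) α p.1 p.2 * δ p.1 p.2 ∂(tau T P) :=
    par_adj e0 he0 hA (f := fun ω s => δ s ω) (g := fun ω s => α s ω) hd ha
  set f0 : ℝ × Ω → ℝ := fun p => α p.1 p.2 * (op2 T A α p.1 p.2 + lam * α p.1 p.2) with hf0
  set f1 : ℝ × Ω → ℝ := fun p => α p.1 p.2 * op2 T A δ p.1 p.2
    + δ p.1 p.2 * (op2 T A α p.1 p.2 + 2 * lam * α p.1 p.2) with hf1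
  set f2 : ℝ × Ω → ℝ := fun p => δ p.1 p.2 * (op2 T A δ p.1 p.2 + lam * δ p.1 p.2) with hf2
  have i0 : Integrable f0 (tau T P) := ha.int_mul (hAa.add (ha.smul lam))
  have i1a : Integrable (fun p : ℝ × Ω => α p.1 p.2 * op2 T A δ p.1 p.2) (tau T P) := ha.int_mul hAd
  have i1b : Integrable (fun p : ℝ × Ω => δ p.1 p.2 * (op2 T A α p.1 p.2 + 2 * lam * α p.1 p.2))
    (tau T P) := hd.int_mul (hAa.add (ha.smul (2 * lam)))
  have i1 : Integrable f1 (tau T P) := i1a.add i1b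
  have i2 : Integrable f2 (tau T P) := hd.int_mul (hAd.add (hd.smul lam))
  have ex : ∀ ε : ℝ, J (fun t ω => α t ω + ε * δ t ω) = J α
      - ε * ((∫ p, f1 p ∂(tau T P)) + (∫ p, δ p.1 p.2 * h p.1 p.2 ∂(tau T P))
        - ∫ p, b p.1 p.2 * δ p.1 p.2 ∂(tau T P)) - ε ^ 2 * ∫ p, f2 p ∂(tau T P) := by
    intro ε
    rw [hJ _ (adm ε), hJ _ hα]
    have q1 : ∫ p, (α p.1 p.2 + ε * δ p.1 p.2) * (op2 T A (fun t ω => α t ω + ε * δ t ω) p.1 p.2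
        + lam * (α p.1 p.2 + ε * δ p.1 p.2)) ∂(tau T P)
        = (∫ p, f0 p ∂(tau T P)) + ε * (∫ p, f1 p ∂(tau T P)) + ε ^ 2 * ∫ p, f2 p ∂(tau T P) := by
      have j1 := iadd i0 (i1.const_mul ε)
      rw [← integral_const_mul, ← integral_const_mul, ← integral_add i0 (i1.const_mul ε),
        ← integral_add j1 (i2.const_mul _)]
      apply integral_congr_ae
      filter_upwards [par_lin e0 he0 hA ε (f := fun ω s => α s ω) (g := fun ω s => δ s ω) ha hd]
        with p hp
      have hp' : op2 T A (fun t ω => α t ω + ε * δ t ω) p.1 p.2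
        = op2 T A α p.1 p.2 + ε * op2 T A δ p.1 p.2 := hp
      rw [hp']
      simp only [hf0, hf1, hf2]; ring
    have q2 : ∫ p, (α p.1 p.2 + ε * δ p.1 p.2) * h p.1 p.2 ∂(tau T P)
        = (∫ p, α p.1 p.2 * h p.1 p.2 ∂(tau T P)) + ε * ∫ p, δ p.1 p.2 * h p.1 p.2 ∂(tau T P) := by
      rw [← integral_const_mul, ← integral_add (ha.int_mul hh) ((hd.int_mul hh).const_mul ε)]
      congr 1; ext p; ring
    have q3 : ∫ p, b p.1 p.2 * (α p.1 p.2 + ε * δ p.1 p.2) ∂(tau T P)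
        = (∫ p, b p.1 p.2 * α p.1 p.2 ∂(tau T P)) + ε * ∫ p, b p.1 p.2 * δ p.1 p.2 ∂(tau T P) := by
      rw [← integral_const_mul, ← integral_add (hb.int_mul ha) ((hb.int_mul hd).const_mul ε)]
      congr 1; ext p; ring
    rw [q1, q2, q3]
    ring
  have key : ∀ ε : ℝ, 0 ≤ (∫ p, f2 p ∂(tau T P)) * (ε * ε)
      + ((∫ p, f1 p ∂(tau T P)) + (∫ p, δ p.1 p.2 * h p.1 p.2 ∂(tau T P))
        - ∫ p, b p.1 p.2 * δ p.1 p.2 ∂(tau T P)) * ε + 0 := by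
    intro ε
    have := hopt _ (adm ε)
    rw [ex ε] at this
    nlinarith
  have hz := discrim_le_zero key
  unfold discrim at hz
  have hz' : (∫ p, f1 p ∂(tau T P)) + (∫ p, δ p.1 p.2 * h p.1 p.2 ∂(tau T P))
        - ∫ p, b p.1 p.2 * δ p.1 p.2 ∂(tau T P) = 0 := by
    apply pow_eq_zero_iff (two_ne_zero) |>.1
    nlinarith [sq_nonneg ((∫ p, f1 p ∂(tau T P)) + (∫ p, δ p.1 p.2 * h p.1 p.2 ∂(tau T P))
        - ∫ p, b p.1 p.2 * δ p.1 p.2 ∂(tau T P))]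
  rw [← hz', hf1, integral_add i1a i1b, adj]
  have k1 := hA'a.int_mul hd
  have k2 := iadd k1 i1b
  have k3 := iadd k2 (hd.int_mul hh)
  rw [← integral_add k1 i1b, ← integral_add k2 (hd.int_mul hh), ← integral_sub k3 (hb.int_mul hd)]
  congr 1; ext p; ring

end setsec

/-! ### The two games -/

section gamesec
variable {mΩ : MeasurableSpace Ω} {P : Measure Ω} [IsProbabilityMeasure P] {T : ℝ}

lemma kernel_Bd {G : ℝ → ℝ → ℝ} (h : IsVolterraKernel T G) : ∃ C, Bd (nuT T) G C :=
  ⟨_, Bd.of_int h.1.1 h.1.2⟩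

lemma graph_foc {F : Filtration ℝ mΩ} {A B Ck : ℝ → ℝ → ℝ} {CA CB CC lam : ℝ}
    (hA : Bd (nuT T) A CA) (hB : Bd (nuT T) B CB) (hC : Bd (nuT T) Ck CC) {N : ℕ}
    {w : Fin N → Fin N → ℝ} (hw : ∀ i, w i i = 0) {b : Fin N → ℝ → Ω → ℝ}
    (hb : ∀ i, Admissible T F P (b i)) {bstar : ℝ → Ω → ℝ} (hbs : Admissible T F P bstar)
    {c : Fin N → Ω → ℝ} (hc : ∀ i, Integrable (c i) P) {α : Fin N → ℝ → Ω → ℝ}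
    (hN : IsNashGraph T F P A B Ck lam w b bstar c α) (i : Fin N) {δ : ℝ → Ω → ℝ}
    (hδ : Admissible T F P δ) :
    ∫ p, δ p.1 p.2 * (2 * lam * α i p.1 p.2 + op2 T A (α i) p.1 p.2
      + op2 T (fun a b => A b a) (α i) p.1 p.2
      + (1 / (N:ℝ)) * ∑ j, w i j * (op2 T B (α j) p.1 p.2 + op2 T (fun a b => B b a) (α j) p.1 p.2)
      - b i p.1 p.2) ∂(tau T P) = 0 := by
  have hα := hN.1
  have hBj : ∀ j, L2 (tau T P) (fun p => op2 T B (α j) p.1 p.2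
      + op2 T (fun a b => B b a) (α j) p.1 p.2) := fun j =>
    (op2_L2 hB (adm_L2 (hα j))).add (op2_L2 hB.swap (adm_L2 (hα j)))
  have hsum : L2 (tau T P) (fun p => ∑ j, w i j * (op2 T B (α j) p.1 p.2
      + op2 T (fun a b => B b a) (α j) p.1 p.2)) := by
    refine L2.of_memLp ?_ ?_
    · exact Finset.measurable_sum _ fun j _ => (hBj j).1.const_mul _
    · exact memLp_finsetSum _ fun j _ => (hBj j).memLp.const_mul (w i j)
  refine foc (R := - (∫ ω, (1 / (N:ℝ)^2) * ∑ j, ∑ k, w i j * w i k *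
          ip T (fun t => α j t ω) (opK T Ck (fun s => α k s ω)) ∂P)
      + (∫ ω, (1 / (N:ℝ)) * ∑ j, w i j * ip T (fun t => bstar t ω) (fun t => α j t ω) ∂P)
      + ∫ ω, c i ω ∂P)
    (J := fun β => Jgraph T P A B Ck lam w b bstar c i (Function.update α i β))
    (h := fun t ω => (1 / (N:ℝ)) * ∑ j, w i j * (op2 T B (α j) t ω
      + op2 T (fun a b => B b a) (α j) t ω))
    hA (hα i) hδ (hsum.smul _) (adm_L2 (hb i)) ?_ ?_
  · intro β hβ
    have hβ2 := adm_L2 hβ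
    have e : Jgraph T P A B Ck lam w b bstar c i (Function.update α i β) = ∫ ω,
        (- ip T (fun t => β t ω) (fun t => op2 T A β t ω + lam * β t ω)
        - (1 / (N:ℝ)) * ∑ j, w i j *
          ip T (fun t => β t ω)
            (fun t => op2 T B (α j) t ω + op2 T (fun a b => B b a) (α j) t ω)
        - (1 / (N:ℝ)^2) * ∑ j, ∑ k, w i j * w i k *
          ip T (fun t => α j t ω) (opK T Ck (fun s => α k s ω))
        + ip T (fun t => b i t ω) (fun t => β t ω)
        + (1 / (N:ℝ)) * ∑ j, w i j * ip T (fun t => bstar t ω) (fun t => α j t ω)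
        + c i ω) ∂P := by
      unfold Jgraph
      congr 1; ext ω
      have s1 : ∀ j, w i j * ip T (fun t => Function.update α i β i t ω)
            (fun t => opK T B (fun s => Function.update α i β j s ω) t
              + opKadj T B (fun s => Function.update α i β j s ω) t)
          = w i j * ip T (fun t => β t ω)
            (fun t => op2 T B (α j) t ω + op2 T (fun a b => B b a) (α j) t ω) := by
        intro j
        by_cases hj : j = i
        · subst hj; rw [hw, zero_mul, zero_mul]
        · rw [Function.update_self, Function.update_of_ne hj]; rfl
      have s2 : ∀ j k, w i j * w i k * ip T (fun t => Function.update α i β j t ω)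
            (opK T Ck (fun s => Function.update α i β k s ω))
          = w i j * w i k * ip T (fun t => α j t ω) (opK T Ck (fun s => α k s ω)) := by
        intro j k
        by_cases hj : j = i
        · subst hj; simp [hw]
        · by_cases hk : k = i
          · subst hk; simp [hw]
          · rw [Function.update_of_ne hj, Function.update_of_ne hk]
      have s3 : ∀ j, w i j * ip T (fun t => bstar t ω) (fun t => Function.update α i β j t ω)
          = w i j * ip T (fun t => bstar t ω) (fun t => α j t ω) := by
        intro j
        by_cases hj : j = i
        · subst hj; simp [hw]
        · rw [Function.update_of_ne hj]
      simp_rw [s1, s2, s3, Function.update_self]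
      rfl
    change Jgraph T P A B Ck lam w b bstar c i (Function.update α i β) = _
    rw [e]
    obtain ⟨a1, a2⟩ := ip_int hβ2 (g := fun t ω => op2 T A β t ω + lam * β t ω)
      ((op2_L2 hA hβ2).add (hβ2.smul lam))
    have b1 := fun j => (ip_int hβ2 (g := fun t ω => op2 T B (α j) t ω
      + op2 T (fun a b => B b a) (α j) t ω) (hBj j)).1
    have b2 := fun j => (ip_int hβ2 (g := fun t ω => op2 T B (α j) t ω
      + op2 T (fun a b => B b a) (α j) t ω) (hBj j)).2
    have b3 : Integrable (fun ω => (1 / (N:ℝ)) * ∑ j, w i j *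
          ip T (fun t => β t ω)
            (fun t => op2 T B (α j) t ω + op2 T (fun a b => B b a) (α j) t ω)) P :=
      (integrable_finsetSum _ fun j _ => (b1 j).const_mul (w i j)).const_mul _
    have c1 : Integrable (fun ω => (1 / (N:ℝ)^2) * ∑ j, ∑ k, w i j * w i k *
          ip T (fun t => α j t ω) (opK T Ck (fun s => α k s ω))) P := by
      refine (integrable_finsetSum _ fun j _ => integrable_finsetSum _ fun k _ => ?_).const_mul _
      exact ((ip_int (adm_L2 (hα j)) (g := fun t ω => op2 T Ck (α k) t ω)
        (op2_L2 hC (adm_L2 (hα k)))).1).const_mul _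
    obtain ⟨d1, d2⟩ := ip_int (adm_L2 (hb i)) hβ2
    have f1 : Integrable (fun ω => (1 / (N:ℝ)) * ∑ j, w i j *
        ip T (fun t => bstar t ω) (fun t => α j t ω)) P :=
      (integrable_finsetSum _ fun j _ =>
        ((ip_int (adm_L2 hbs) (adm_L2 (hα j))).1).const_mul (w i j)).const_mul _
    have g1 : Integrable (fun ω => - ip T (fun t => β t ω)
      (fun t => op2 T A β t ω + lam * β t ω)) P := a1.neg
    have g2 := g1.sub' b3
    have g3 := g2.sub' c1
    have g4 := iadd g3 d1
    have g5 := iadd g4 f1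
    rw [integral_add g5 (hc i), integral_add g4 f1, integral_add g3 d1, integral_sub g2 c1,
      integral_sub g1 b3, integral_neg, a2, d2]
    have b4 : ∫ ω, (1 / (N:ℝ)) * ∑ j, w i j *
          ip T (fun t => β t ω)
            (fun t => op2 T B (α j) t ω + op2 T (fun a b => B b a) (α j) t ω) ∂P
        = ∫ p, β p.1 p.2 * ((1 / (N:ℝ)) * ∑ j, w i j * (op2 T B (α j) p.1 p.2
      + op2 T (fun a b => B b a) (α j) p.1 p.2)) ∂(tau T P) := by
      rw [integral_const_mul, integral_finsetSum _ fun j _ => (b1 j).const_mul (w i j)]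
      simp_rw [integral_const_mul, b2]
      have : ∀ p : ℝ × Ω, β p.1 p.2 * ((1 / (N:ℝ)) * ∑ j, w i j * (op2 T B (α j) p.1 p.2
        + op2 T (fun a b => B b a) (α j) p.1 p.2)) = (1 / (N:ℝ)) * ∑ j, w i j * (β p.1 p.2 *
          (op2 T B (α j) p.1 p.2 + op2 T (fun a b => B b a) (α j) p.1 p.2)) := by
        intro p
        rw [Finset.mul_sum, Finset.mul_sum, Finset.mul_sum]
        exact Finset.sum_congr rfl fun j _ => by ring
      simp_rw [this]
      rw [integral_const_mul, integral_finsetSum _ fun j _ =>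
        (hβ2.int_mul (hBj j)).const_mul (w i j)]
      simp_rw [integral_const_mul]
    rw [b4]
    ring
  · intro β hβ
    have := hN.2 i β hβ
    simpa only [Function.update_eq_self] using this

lemma graphon_foc {F : Filtration ℝ mΩ} {A B Ck V : ℝ → ℝ → ℝ} {CA CB CC CV lam : ℝ}
    (hA : Bd (nuT T) A CA) (hB : Bd (nuT T) B CB) (hC : Bd (nuT T) Ck CC) (hV : Bd rho V CV)
    {b : ℝ → ℝ → Ω → ℝ}
    (hb : L3 T P b) {bstar : ℝ → Ω → ℝ} (hbs : Admissible T F P bstar)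
    {c : ℝ → Ω → ℝ} (hc : ∀ u, Integrable (c u) P) {α : ℝ → ℝ → Ω → ℝ}
    (hN : IsGraphonNash T F P A B Ck lam V b bstar c α) :
    ∀ᵐ u ∂rho, ∀ δ, Admissible T F P δ →
      ∫ p, δ p.1 p.2 * (Lop T lam A B V α u p.1 p.2 - b u p.1 p.2) ∂(tau T P) = 0 := by
  have hα : L3 T P α := ⟨hN.1.1, hN.1.2.2.2⟩
  have hM := (opU_L3 hV hα).1
  have hmem : ∀ᵐ u ∂rho, u ∈ Icc (0:ℝ) 1 := ae_restrict_mem measurableSet_Icc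
  have cB := Measure.ae_ae_of_ae_prod (comm3 hB hV hα)
  have cB' := Measure.ae_ae_of_ae_prod (comm3 hB.swap hV hα)
  have hopt : ∀ᵐ u ∂rho, ∀ β : ℝ → Ω → ℝ, ProgMeasurable F β → SqInt T P β →
        Jgr T P A B Ck lam V b bstar c u (Function.update α u β)
          ≤ Jgr T P A B Ck lam V b bstar c u α := hN.2
  have hsq : ∀ᵐ u ∂rho, SqInt T P (α u) := hN.1.2.2.1
  filter_upwards [hmem, cB, cB', hopt, hsq, hb.slice_u, hM.slice_u]
    with u hu cB cB' hopt hsq hbu hMu δ hδ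
  have hαu : Admissible T F P (α u) := ⟨hN.1.2.1 u hu, hsq⟩
  set M : ℝ → Ω → ℝ := fun t ω => opU V α u t ω with hMdef
  have hBM : L2 (tau T P) (fun p => op2 T B M p.1 p.2 + op2 T (fun a b => B b a) M p.1 p.2) :=
    (op2_L2 hB hMu).add (op2_L2 hB.swap hMu)
  have hCM : L2 (tau T P) (fun p => op2 T Ck M p.1 p.2) := op2_L2 hC hMu
  have main := foc (lam := lam) (R := - (∫ ω, ip T (fun t => M t ω) (fun t => op2 T Ck M t ω) ∂P)
      + (∫ ω, ip T (fun t => bstar t ω) (fun t => M t ω) ∂P) + ∫ ω, c u ω ∂P)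
    (J := fun β => Jgr T P A B Ck lam V b bstar c u (Function.update α u β))
    (h := fun t ω => op2 T B M t ω + op2 T (fun a b => B b a) M t ω)
    hA hαu hδ hBM hbu ?_ ?_
  · rw [← main]
    apply integral_congr_ae
    filter_upwards [cB, cB'] with p h1 h2
    have h1' : op2 T B M p.1 p.2 = opU V (opT T B α) u p.1 p.2 := h1
    have h2' : op2 T (fun a b => B b a) M p.1 p.2 = opU V (opT T (fun a b => B b a) α) u p.1 p.2 := h2
    rw [h1', h2']
    simp only [Lop, opT, op2]
    ring
  · intro β hβ
    have hβ2 := adm_L2 hβ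
    have upd : ∀ s ω, ∫ v in Icc (0:ℝ) 1, V u v * Function.update α u β v s ω = M s ω := by
      intro s ω
      change ∫ v, V u v * Function.update α u β v s ω ∂rho = ∫ v, V u v * α v s ω ∂rho
      apply integral_congr_ae
      have : ∀ᵐ v ∂rho, v ≠ u := by
        have : ∀ᵐ v ∂(volume : Measure ℝ), v ≠ u := Measure.ae_ne volume u
        exact ae_restrict_of_ae this
      filter_upwards [this] with v hv
      rw [Function.update_of_ne hv]
    have e : Jgr T P A B Ck lam V b bstar c u (Function.update α u β) = ∫ ω,
        (- ip T (fun t => β t ω) (fun t => op2 T A β t ω + lam * β t ω)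
        - ip T (fun t => β t ω) (fun t => op2 T B M t ω + op2 T (fun a b => B b a) M t ω)
        - ip T (fun t => M t ω) (fun t => op2 T Ck M t ω)
        + ip T (fun t => b u t ω) (fun t => β t ω)
        + ip T (fun t => bstar t ω) (fun t => M t ω)
        + c u ω) ∂P := by
      unfold Jgr
      simp_rw [upd, Function.update_self]
      rfl
    change Jgr T P A B Ck lam V b bstar c u (Function.update α u β) = _
    rw [e]
    obtain ⟨a1, a2⟩ := ip_int hβ2 (g := fun t ω => op2 T A β t ω + lam * β t ω)
      ((op2_L2 hA hβ2).add (hβ2.smul lam))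
    obtain ⟨b1, b2⟩ := ip_int hβ2 (g := fun t ω => op2 T B M t ω
      + op2 T (fun a b => B b a) M t ω) hBM
    obtain ⟨c1, c2⟩ := ip_int hMu (g := fun t ω => op2 T Ck M t ω) hCM
    obtain ⟨d1, d2⟩ := ip_int hbu hβ2
    obtain ⟨f1, f2⟩ := ip_int (adm_L2 hbs) hMu
    have g1 : Integrable (fun ω => - ip T (fun t => β t ω)
      (fun t => op2 T A β t ω + lam * β t ω)) P := a1.neg
    have g2 := g1.sub' b1
    have g3 := g2.sub' c1
    have g4 := iadd g3 d1
    have g5 := iadd g4 f1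
    rw [integral_add g5 (hc u), integral_add g4 f1, integral_add g3 d1, integral_sub g2 c1,
      integral_sub g1 b1, integral_neg, a2, d2, b2]
    ring
  · intro β hβ
    have := hopt β hβ.1 hβ.2
    simpa only [Function.update_eq_self] using this

end gamesec

/-! ### Step profiles and the stability estimate -/

section stepsec
variable {mΩ : MeasurableSpace Ω} {P : Measure Ω} [IsProbabilityMeasure P] {T : ℝ}

def stepP {N : ℕ} (hN : 0 < N) (g : Fin N → ℝ → Ω → ℝ) : ℝ → ℝ → Ω → ℝ :=
  fun u t ω => g (idx N hN u) t ω

lemma stepP_L3 {N : ℕ} (hN : 0 < N) {g : Fin N → ℝ → Ω → ℝ}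
    (hg : ∀ i, L2 (tau T P) (fun p => g i p.1 p.2)) : L3 T P (stepP hN g) := by
  have hm : Measurable (fun q : ℝ × ℝ × Ω => stepP hN g q.1 q.2.1 q.2.2) := by
    have h1 : Measurable (fun z : Fin N × ℝ × Ω => g z.1 z.2.1 z.2.2) :=
      measurable_from_prod_countable_right fun i => (hg i).1
    exact h1.comp (((idx_meas N hN).comp measurable_fst).prodMk measurable_snd)
  refine ⟨hm, ?_⟩
  have hi : Integrable (fun q : ℝ × ℝ × Ω => ∑ i, (g i q.2.1 q.2.2) ^ 2) (mu3 T P) :=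
    integrable_finsetSum _ fun i _ => (hg i).2.comp_snd rho
  refine hi.mono' (hm.pow_const 2).aestronglyMeasurable (Eventually.of_forall fun q => ?_)
  rw [Real.norm_of_nonneg (sq_nonneg _)]
  exact Finset.single_le_sum (f := fun i => (g i q.2.1 q.2.2) ^ 2) (fun i _ => sq_nonneg _)
    (Finset.mem_univ (idx N hN q.1))

lemma stepW_meas {N : ℕ} (hN : 0 < N) (w : Fin N → Fin N → ℝ) :
    Measurable (Function.uncurry (stepW N w)) := by
  have h : Function.uncurry (stepW N w)
      = (fun z : Fin N × Fin N => w z.1 z.2) ∘ (fun p : ℝ × ℝ => (idx N hN p.1, idx N hN p.2)) := by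
    ext p
    exact stepW_eq N hN w p.1 p.2
  rw [h]
  exact (measurable_of_finite _).comp (((idx_meas N hN).comp measurable_fst).prodMk
    ((idx_meas N hN).comp measurable_snd))

lemma opU_step {N : ℕ} (hN : 0 < N) (w : Fin N → Fin N → ℝ) (k : ℝ → ℝ → ℝ)
    (g : Fin N → ℝ → Ω → ℝ) (u t : ℝ) (ω : Ω) :
    opU (stepW N w) (opT T k (stepP hN g)) u t ω
      = (1 / (N:ℝ)) * ∑ j, w (idx N hN u) j * op2 T k (g j) t ω := by
  rw [← idx_int N hN (fun j => w (idx N hN u) j * op2 T k (g j) t ω)]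
  unfold opU kop
  congr 1; ext v
  rw [stepW_eq N hN]; rfl

lemma graph_foc' {F : Filtration ℝ mΩ} {A B Ck : ℝ → ℝ → ℝ} {CA CB CC lam : ℝ}
    (hA : Bd (nuT T) A CA) (hB : Bd (nuT T) B CB) (hC : Bd (nuT T) Ck CC) {N : ℕ} (hN : 0 < N)
    {w : Fin N → Fin N → ℝ} (hw : ∀ i, w i i = 0) {b : Fin N → ℝ → Ω → ℝ}
    (hb : ∀ i, Admissible T F P (b i)) {bstar : ℝ → Ω → ℝ} (hbs : Admissible T F P bstar)
    {c : Fin N → Ω → ℝ} (hc : ∀ i, Integrable (c i) P) {α : Fin N → ℝ → Ω → ℝ}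
    (hNa : IsNashGraph T F P A B Ck lam w b bstar c α) (u : ℝ) {δ : ℝ → Ω → ℝ}
    (hδ : Admissible T F P δ) :
    ∫ p, δ p.1 p.2 * (Lop T lam A B (stepW N w) (stepP hN α) u p.1 p.2
      - stepP hN b u p.1 p.2) ∂(tau T P) = 0 := by
  rw [← graph_foc hA hB hC hw hb hbs hc hNa (idx N hN u) hδ]
  congr 1; ext p
  simp only [Lop]
  rw [opU_step hN, opU_step hN]
  simp only [mul_add, Finset.sum_add_distrib]
  simp only [opT, op2, stepP]
  ring

lemma graph_bound {F : Filtration ℝ mΩ} {A B Ck : ℝ → ℝ → ℝ} {CA CB CC lam c₀ : ℝ}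
    (hA : Bd (nuT T) A CA) (hB : Bd (nuT T) B CB) (hC : Bd (nuT T) Ck CC) {N : ℕ} (hN : 0 < N)
    {w : Fin N → Fin N → ℝ} (hw : ∀ i, w i i = 0) (hws : ∀ i j, w i j = w j i)
    (hw1 : ∀ i j, w i j ∈ Icc (0:ℝ) 1) {b : Fin N → ℝ → Ω → ℝ}
    (hb : ∀ i, Admissible T F P (b i)) {bstar : ℝ → Ω → ℝ} (hbs : Admissible T F P bstar)
    {c : Fin N → Ω → ℝ} (hc : ∀ i, Integrable (c i) P) {α : Fin N → ℝ → Ω → ℝ}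
    (hNa : IsNashGraph T F P A B Ck lam w b bstar c α) (hc₀ : 0 < c₀)
    (hco : CoercGraph T A B lam w c₀) :
    4 * c₀ ^ 2 * ∫ q, (stepP hN α q.1 q.2.1 q.2.2) ^ 2 ∂(mu3 T P)
      ≤ ∫ q, (stepP hN b q.1 q.2.1 q.2.2) ^ 2 ∂(mu3 T P) := by
  have hα := hNa.1
  have hD : L3 T P (stepP hN α) := stepP_L3 hN fun i => adm_L2 (hα i)
  have hr : L3 T P (stepP hN b) := stepP_L3 hN fun i => adm_L2 (hb i)
  obtain ⟨CV, hV⟩ := Bd.of_bdd (U := stepW N w) (stepW_meas hN w) (fun u v => by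
    rw [stepW_eq N hN, abs_of_nonneg (hw1 _ _).1]; exact (hw1 _ _).2)
  refine energy (lam := lam) hA hB hV (fun u v => by rw [stepW_eq N hN, stepW_eq N hN, hws]) hc₀ hD hr ?_ ?_
  · have hL : L3 T P (Lop T lam A B (stepW N w) (stepP hN α)) :=
      ((((L2.smul (2 * lam) hD).add (opT_L3 hA hD).1).add (opT_L3 hA.swap hD).1).add
        (opU_L3 hV (opT_L3 hB hD).1).1).add (opU_L3 hV (opT_L3 hB.swap hD).1).1
    have hi := L2.int_mul hD (L2.sub hL hr)
    unfold mu3 at hi ⊢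
    rw [integral_prod _ hi]
    have : ∀ u : ℝ, ∫ p : ℝ × Ω, stepP hN α u p.1 p.2 * (Lop T lam A B (stepW N w) (stepP hN α) u p.1 p.2
      - stepP hN b u p.1 p.2) ∂(tau T P) = 0 := fun u =>
      graph_foc' hA hB hC hN hw hb hbs hc hNa u (hα (idx N hN u))
    simp only [this, integral_zero]
  · have hs : ∀ᵐ ω ∂P, ∀ i, L2 (nuT T) (fun t => α i t ω) := by
      rw [ae_all_iff]
      intro i
      exact L2.slice (f := fun (ω : Ω) (t : ℝ) => α i t ω)
        ((L2.comp_e e0 he0 (F := fun z => α i z.2 z.1)).1 (adm_L2 (hα i)))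
    filter_upwards [hs] with ω hω
    have hk := hco (fun t i => α i t ω) ⟨fun i => (hω i).1,
      integrable_finsetSum _ fun i _ => (hω i).2⟩
    have hBj : ∀ j, L2 (nuT T) (kop (nuT T) B fun s => α j s ω) := fun j => hB.L2 (hω j)
    have hsum : ∀ i, L2 (nuT T) (fun t => ∑ j, w i j * kop (nuT T) B (fun s => α j s ω) t) := by
      intro i
      refine L2.of_memLp ?_ ?_
      · exact Finset.measurable_sum _ fun j _ => (hBj j).1.const_mul _
      · exact memLp_finsetSum _ fun j _ => (hBj j).memLp.const_mul (w i j)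
    have h1 : ∫ u, ∫ t, (stepP hN α u t ω) ^ 2 ∂(nuT T) ∂rho
        = (1 / (N:ℝ)) * ∫ t in Icc (0:ℝ) T, ∑ i, (α i t ω) ^ 2 := by
      have e1 : ∫ t in Icc (0:ℝ) T, ∑ i, (α i t ω) ^ 2 = ∑ i, ∫ t, (α i t ω) ^ 2 ∂(nuT T) :=
        integral_finsetSum _ fun i _ => (hω i).2
      rw [e1]
      exact idx_int N hN (fun i => ∫ t, (α i t ω) ^ 2 ∂(nuT T))
    have h2 : ∫ u, ∫ t, stepP hN α u t ω * (lam * stepP hN α u t ω + opT T A (stepP hN α) u t ω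
          + opU (stepW N w) (opT T B (stepP hN α)) u t ω) ∂(nuT T) ∂rho
        = (1 / (N:ℝ)) * ∫ t in Icc (0:ℝ) T, ∑ i, α i t ω * (lam * α i t ω
          + opK T A (fun s => α i s ω) t
          + (1 / (N:ℝ)) * ∑ j, w i j * opK T B (fun s => α j s ω) t) := by
      have e1 : ∫ t in Icc (0:ℝ) T, ∑ i, α i t ω * (lam * α i t ω
          + opK T A (fun s => α i s ω) t
          + (1 / (N:ℝ)) * ∑ j, w i j * opK T B (fun s => α j s ω) t)
          = ∑ i, ∫ t, α i t ω * (lam * α i t ω + opK T A (fun s => α i s ω) t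
          + (1 / (N:ℝ)) * ∑ j, w i j * opK T B (fun s => α j s ω) t) ∂(nuT T) :=
        integral_finsetSum _ fun i _ => (hω i).int_mul
          ((((hω i).smul lam).add (hA.L2 (hω i))).add ((hsum i).smul (1 / (N:ℝ))))
      rw [e1, ← idx_int N hN]
      congr 1; ext u
      congr 1; ext t
      rw [opU_step hN]
      rfl
    rw [h1, h2]
    calc c₀ * ((1 / (N:ℝ)) * ∫ t in Icc (0:ℝ) T, ∑ i, (α i t ω) ^ 2)
        = (1 / (N:ℝ)) * (c₀ * ∫ t in Icc (0:ℝ) T, ∑ i, (α i t ω) ^ 2) := by ring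
      _ ≤ _ := mul_le_mul_of_nonneg_left hk (by positivity)

lemma coercW_path {A B W : ℝ → ℝ → ℝ} {CA CB CW lam cW : ℝ}
    (hA : Bd (nuT T) A CA) (hB : Bd (nuT T) B CB) (hW : Bd rho W CW)
    (hco : ∀ g : ℝ → ℝ → ℝ, MemL2TI T g →
      cW * (∫ u in Icc (0:ℝ) 1, ∫ t in Icc (0:ℝ) T, (g t u) ^ 2) ≤
        ∫ u in Icc (0:ℝ) 1, ∫ t in Icc (0:ℝ) T,
          g t u * (lam * g t u + opK T A (fun s => g s u) t
            + opK T B (fun s => ∫ v in Icc (0:ℝ) 1, W u v * g s v) t))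
    {D : ℝ → ℝ → Ω → ℝ} (hD : L3 T P D) :
    ∀ᵐ ω ∂P, cW * ∫ u, ∫ t, (D u t ω) ^ 2 ∂(nuT T) ∂rho ≤
      ∫ u, ∫ t, D u t ω * (lam * D u t ω + opT T A D u t ω + opU W (opT T B D) u t ω)
        ∂(nuT T) ∂rho := by
  filter_upwards [hD.slice_ω] with ω hω
  have hk := hco (fun t u => D u t ω) ⟨hω.1.comp measurable_swap, hω.2.swap⟩
  refine hk.trans (le_of_eq ?_)
  apply integral_congr_ae
  filter_upwards [row_L2 hW.meas hW.int] with u hu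
  apply integral_congr_ae
  filter_upwards [row_L2 hB.meas hB.int] with t ht
  have := comm_path (D := fun v s => D v s ω) hω hu ht
  have e : opK T B (fun s => ∫ v in Icc (0:ℝ) 1, W u v * D v s ω) t = opU W (opT T B D) u t ω := this
  simp only [e]
  rfl

end stepsec

section stabsec
variable {mΩ : MeasurableSpace Ω} {P : Measure Ω} [IsProbabilityMeasure P] {T : ℝ}

lemma opU_ksub {W V : ℝ → ℝ → ℝ} {CW CV : ℝ} (hW : Bd rho W CW) (hV : Bd rho V CV)
    {x : ℝ → ℝ → Ω → ℝ} (hx : L3 T P x) :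
    ∀ᵐ q ∂(mu3 T P), opU (fun u v => W u v - V u v) x q.1 q.2.1 q.2.2
      = opU W x q.1 q.2.1 q.2.2 - opU V x q.1 q.2.1 q.2.2 := by
  have h1 : ∀ᵐ q ∂(mu3 T P), L2 rho (W q.1) :=
    Measure.quasiMeasurePreserving_fst.ae (row_L2 hW.meas hW.int)
  have h2 : ∀ᵐ q ∂(mu3 T P), L2 rho (V q.1) :=
    Measure.quasiMeasurePreserving_fst.ae (row_L2 hV.meas hV.int)
  have h3 : ∀ᵐ z ∂(tau T P), L2 rho (fun v => x v z.1 z.2) :=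
    L2.slice (f := fun (z : ℝ × Ω) (v : ℝ) => x v z.1 z.2)
      ((L2.comp_e e2 he2 (F := fun z => x z.2 z.1.1 z.1.2)).1 hx)
  have h4 : ∀ᵐ q ∂(mu3 T P), L2 rho (fun v => x v q.2.1 q.2.2) :=
    Measure.quasiMeasurePreserving_snd.ae h3
  filter_upwards [h1, h2, h4] with q h1 h2 h4
  unfold opU kop
  rw [← integral_sub (h1.int_mul h4) (h2.int_mul h4)]
  congr 1; ext v; ring

lemma Lop_L3 {A B V : ℝ → ℝ → ℝ} {CA CB CV lam : ℝ}
    (hA : Bd (nuT T) A CA) (hB : Bd (nuT T) B CB) (hV : Bd rho V CV) {f : ℝ → ℝ → Ω → ℝ}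
    (hf : L3 T P f) : L3 T P (Lop T lam A B V f) :=
  ((((L2.smul (2 * lam) hf).add (opT_L3 hA hf).1).add (opT_L3 hA.swap hf).1).add
        (opU_L3 hV (opT_L3 hB hf).1).1).add (opU_L3 hV (opT_L3 hB.swap hf).1).1

lemma opUT_lin {B V : ℝ → ℝ → ℝ} {CB CV : ℝ} (hB : Bd (nuT T) B CB) (hV : Bd rho V CV)
    {f g : ℝ → ℝ → Ω → ℝ} (a : ℝ) (hf : L3 T P f) (hg : L3 T P g) :
    ∀ᵐ q ∂(mu3 T P), opU V (opT T B (fun u t ω => f u t ω + a * g u t ω)) q.1 q.2.1 q.2.2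
      = opU V (opT T B f) q.1 q.2.1 q.2.2 + a * opU V (opT T B g) q.1 q.2.1 q.2.2 := by
  filter_upwards [opU_congr (V := V) (g := fun u t ω => opT T B f u t ω + a * opT T B g u t ω)
    (opT_lin hB a hf hg), opU_lin hV a (opT_L3 hB hf).1 (opT_L3 hB hg).1] with q h1 h2
  rw [h1, h2]

lemma stability {F : Filtration ℝ mΩ} {A B W V : ℝ → ℝ → ℝ} {CA CB CW CV CU lam cW : ℝ}
    (hA : Bd (nuT T) A CA) (hB : Bd (nuT T) B CB) (hW : Bd rho W CW) (hV : Bd rho V CV)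
    (hU : Bd rho (fun u v => W u v - V u v) CU) (hWs : ∀ u v, W u v = W v u) (hcW : 0 < cW)
    (hco : ∀ g : ℝ → ℝ → ℝ, MemL2TI T g →
      cW * (∫ u in Icc (0:ℝ) 1, ∫ t in Icc (0:ℝ) T, (g t u) ^ 2) ≤
        ∫ u in Icc (0:ℝ) 1, ∫ t in Icc (0:ℝ) T,
          g t u * (lam * g t u + opK T A (fun s => g s u) t
            + opK T B (fun s => ∫ v in Icc (0:ℝ) 1, W u v * g s v) t))
    {α αs b bs : ℝ → ℝ → Ω → ℝ} (hα : L3 T P α) (hαs : L3 T P αs) (hb : L3 T P b)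
    (hbs : L3 T P bs)
    (adm : ∀ᵐ u ∂rho, Admissible T F P (fun t ω => α u t ω + (-1) * αs u t ω))
    (f1 : ∀ᵐ u ∂rho, ∀ δ, Admissible T F P δ →
      ∫ p, δ p.1 p.2 * (Lop T lam A B W α u p.1 p.2 - b u p.1 p.2) ∂(tau T P) = 0)
    (f2 : ∀ᵐ u ∂rho, ∀ δ, Admissible T F P δ →
      ∫ p, δ p.1 p.2 * (Lop T lam A B V αs u p.1 p.2 - bs u p.1 p.2) ∂(tau T P) = 0) :
    4 * cW ^ 2 * ∫ q, (α q.1 q.2.1 q.2.2 - αs q.1 q.2.1 q.2.2) ^ 2 ∂(mu3 T P) ≤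
      3 * ((∫ q, (b q.1 q.2.1 q.2.2 - bs q.1 q.2.1 q.2.2) ^ 2 ∂(mu3 T P))
        + CU * (CB + ∫ p, (B p.2 p.1) ^ 2 ∂((nuT T).prod (nuT T)))
          * ∫ q, (αs q.1 q.2.1 q.2.2) ^ 2 ∂(mu3 T P)) := by
  set D : ℝ → ℝ → Ω → ℝ := fun u t ω => α u t ω + (-1) * αs u t ω with hDdef
  set x : ℝ → ℝ → Ω → ℝ := opU (fun u v => W u v - V u v) (opT T B αs) with hx
  set y : ℝ → ℝ → Ω → ℝ := opU (fun u v => W u v - V u v) (opT T (fun a b => B b a) αs) with hy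
  set r : ℝ → ℝ → Ω → ℝ := fun u t ω => (b u t ω - bs u t ω) - x u t ω - y u t ω with hrdef
  have hD : L3 T P D := L2.add hα (L2.smul (-1) hαs)
  obtain ⟨hB1, hB1b⟩ := opT_L3 hB hαs
  obtain ⟨hB2, hB2b⟩ := opT_L3 hB.swap hαs
  obtain ⟨hxL, hxb⟩ := opU_L3 hU hB1
  obtain ⟨hyL, hyb⟩ := opU_L3 hU hB2
  have hbb : L2 (mu3 T P) (fun q => b q.1 q.2.1 q.2.2 - bs q.1 q.2.1 q.2.2) := L2.sub hb hbs
  have hr : L3 T P r := (hbb.sub hxL).sub hyL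
  have hE1 : L2 (mu3 T P) (fun q => Lop T lam A B W α q.1 q.2.1 q.2.2 - b q.1 q.2.1 q.2.2) :=
    L2.sub (Lop_L3 hA hB hW hα) hb
  have hE2 : L2 (mu3 T P) (fun q => Lop T lam A B V αs q.1 q.2.1 q.2.2 - bs q.1 q.2.1 q.2.2) :=
    L2.sub (Lop_L3 hA hB hV hαs) hbs
  have z1 : ∫ q, D q.1 q.2.1 q.2.2 * (Lop T lam A B W α q.1 q.2.1 q.2.2 - b q.1 q.2.1 q.2.2)
      ∂(mu3 T P) = 0 := by
    have hi := L2.int_mul hD hE1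
    unfold mu3 at hi ⊢
    rw [integral_prod _ hi]
    apply integral_eq_zero_of_ae
    filter_upwards [adm, f1] with u ha hf
    exact hf _ ha
  have z2 : ∫ q, D q.1 q.2.1 q.2.2 * (Lop T lam A B V αs q.1 q.2.1 q.2.2 - bs q.1 q.2.1 q.2.2)
      ∂(mu3 T P) = 0 := by
    have hi := L2.int_mul hD hE2
    unfold mu3 at hi ⊢
    rw [integral_prod _ hi]
    apply integral_eq_zero_of_ae
    filter_upwards [adm, f2] with u ha hf
    exact hf _ ha
  have h0 : ∫ q, D q.1 q.2.1 q.2.2 * (Lop T lam A B W D q.1 q.2.1 q.2.2 - r q.1 q.2.1 q.2.2)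
      ∂(mu3 T P) = 0 := by
    have e : ∀ᵐ q ∂(mu3 T P),
        D q.1 q.2.1 q.2.2 * (Lop T lam A B W D q.1 q.2.1 q.2.2 - r q.1 q.2.1 q.2.2)
        = D q.1 q.2.1 q.2.2 * (Lop T lam A B W α q.1 q.2.1 q.2.2 - b q.1 q.2.1 q.2.2)
        - D q.1 q.2.1 q.2.2 * (Lop T lam A B V αs q.1 q.2.1 q.2.2 - bs q.1 q.2.1 q.2.2) := by
      filter_upwards [opT_lin hA (-1) hα hαs, opT_lin hA.swap (-1) hα hαs,
        opUT_lin hB hW (-1) hα hαs, opUT_lin hB.swap hW (-1) hα hαs,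
        opU_ksub hW hV hB1, opU_ksub hW hV hB2] with q a1 a2 a3 a4 a5 a6
      rw [← mul_sub]
      congr 1
      simp only [Lop, hrdef]
      rw [a1, a2, a3, a4, hx, hy, a5, a6, hDdef]
      ring
    rw [integral_congr_ae e, integral_sub (L2.int_mul hD hE1) (L2.int_mul hD hE2), z1, z2, sub_zero]
  have hen := energy hA hB hW hWs hcW hD hr h0 (coercW_path hA hB hW hco hD)
  have hDe : ∫ q, (D q.1 q.2.1 q.2.2) ^ 2 ∂(mu3 T P)
      = ∫ q, (α q.1 q.2.1 q.2.2 - αs q.1 q.2.1 q.2.2) ^ 2 ∂(mu3 T P) := by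
    congr 1; ext q; simp only [hDdef]; ring
  rw [hDe] at hen
  refine hen.trans ?_
  have hbd : ∫ q, (r q.1 q.2.1 q.2.2) ^ 2 ∂(mu3 T P) ≤
      3 * ((∫ q, (b q.1 q.2.1 q.2.2 - bs q.1 q.2.1 q.2.2) ^ 2 ∂(mu3 T P))
        + (∫ q, (x q.1 q.2.1 q.2.2) ^ 2 ∂(mu3 T P)) + ∫ q, (y q.1 q.2.1 q.2.2) ^ 2 ∂(mu3 T P)) := by
    have j1 := iadd hbb.2 hxL.2
    have j2 := iadd j1 hyL.2
    rw [← integral_add hbb.2 hxL.2, ← integral_add j1 hyL.2, ← integral_const_mul]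
    refine integral_mono hr.2 (j2.const_mul 3) fun q => ?_
    have key : ∀ a1 a2 a3 : ℝ, (a1 - a2 - a3) ^ 2 ≤ 3 * (a1 ^ 2 + a2 ^ 2 + a3 ^ 2) := by
      intro a1 a2 a3
      nlinarith [sq_nonneg (a1 + a2), sq_nonneg (a1 + a3), sq_nonneg (a2 - a3)]
    exact key _ _ _
  refine hbd.trans (mul_le_mul_of_nonneg_left ?_ (by norm_num))
  have k1 := hxb.trans (mul_le_mul_of_nonneg_left hB1b hU.C0)
  have k2 := hyb.trans (mul_le_mul_of_nonneg_left hB2b hU.C0)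
  have k3 := add_le_add k1 k2
  rw [add_assoc]
  refine (add_le_add_right k3 _).trans (le_of_eq ?_)
  ring

end stabsec

/-- Convergence (with rate) of the Nash equilibria of `N`-player
graph games to the Nash equilibrium of the limiting graphon game, for a given graph
sequence converging in cut norm. -/
theorem convergence_given_graphs
    {Ω : Type} {mΩ : MeasurableSpace Ω} (P : Measure Ω) [IsProbabilityMeasure P]
    (F : Filtration ℝ mΩ) (T : ℝ) (hT : 0 < T)
    (Atil Btil Ctil : ℝ → ℝ → ℝ)
    (hA : IsVolterraKernel T Atil) (hBk : IsVolterraKernel T Btil)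
    (hCk : IsVolterraKernel T Ctil)
    (hsup : ∃ Cs : ℝ, ∀ t ∈ Icc (0:ℝ) T,
      (∫ s in Icc (0:ℝ) T, ((Atil t s) ^ 2 + (Btil t s) ^ 2)) ≤ Cs ∧
        (∫ s in Icc (0:ℝ) T, ((Atil s t) ^ 2 + (Btil s t) ^ 2)) ≤ Cs)
    (lam : ℝ) (hlam : 0 < lam)
    (w : (N : ℕ) → Fin N → Fin N → ℝ)
    (hw01 : ∀ (N : ℕ) (i j : Fin N), w N i j ∈ Icc (0:ℝ) 1)
    (hwsymm : ∀ (N : ℕ) (i j : Fin N), w N i j = w N j i)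
    (hwdiag : ∀ (N : ℕ) (i : Fin N), w N i i = 0)
    (bN : (N : ℕ) → Fin N → ℝ → Ω → ℝ)
    (hbN : ∀ (N : ℕ) (i : Fin N), ProgMeasurable F (bN N i) ∧ SqInt T P (bN N i))
    (bstar : ℝ → Ω → ℝ) (hbstar : ProgMeasurable F bstar ∧ SqInt T P bstar)
    (cN : (N : ℕ) → Fin N → Ω → ℝ)
    (hcN : ∀ (N : ℕ) (i : Fin N), Integrable (cN N i) P ∧ Measurable[F T] (cN N i))
    (c₀ : ℝ) (hc₀ : 0 < c₀)
    (hcoercN : ∀ N : ℕ, 0 < N → CoercGraph T Atil Btil lam (w N) c₀)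
    (αN : (N : ℕ) → Fin N → ℝ → Ω → ℝ)
    (hNashN : ∀ N : ℕ, 0 < N →
      IsNashGraph T F P Atil Btil Ctil lam (w N) (bN N) bstar (cN N) (αN N))
    (W : ℝ → ℝ → ℝ) (hW : IsGraphon W)
    (b : ℝ → ℝ → Ω → ℝ)
    (hbmeas : Measurable fun q : ℝ × ℝ × Ω => b q.1 q.2.1 q.2.2)
    (hbL2 : Integrable (fun q : ℝ × ℝ × Ω => (b q.1 q.2.1 q.2.2) ^ 2)
      ((volume.restrict (Icc (0:ℝ) 1)).prod ((volume.restrict (Icc (0:ℝ) T)).prod P)))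
    (hbprog : ∀ᵐ u ∂(volume.restrict (Icc (0:ℝ) 1)), ProgMeasurable F (b u))
    (c : ℝ → Ω → ℝ) (hc : ∀ u, Integrable (c u) P ∧ Measurable[F T] (c u))
    (hApos : ∀ f : ℝ → ℝ, MemL2 T f → 0 ≤ ip T f (opK T Atil f))
    (cW : ℝ) (hcW : 0 < cW)
    (hcoercW : ∀ g : ℝ → ℝ → ℝ, MemL2TI T g →
      cW * (∫ u in Icc (0:ℝ) 1, ∫ t in Icc (0:ℝ) T, (g t u) ^ 2) ≤
        ∫ u in Icc (0:ℝ) 1, ∫ t in Icc (0:ℝ) T,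
          g t u * (lam * g t u + opK T Atil (fun s => g s u) t
            + opK T Btil (fun s => ∫ v in Icc (0:ℝ) 1, W u v * g s v) t))
    (αhat : ℝ → ℝ → Ω → ℝ)
    (hαhat : IsGraphonNash T F P Atil Btil Ctil lam W b bstar c αhat)
    (ψ : ℕ → ℝ) (hψ0 : ∀ N, 0 ≤ ψ N) (hψbdd : ∃ Cψ : ℝ, ∀ N, ψ N ≤ Cψ)
    (hψlim : Tendsto ψ atTop (nhds 0))
    (hnoise : ∀ N : ℕ, 0 < N →
      Real.sqrt (∫ ω, (∫ u in Icc (0:ℝ) 1, ∫ t in Icc (0:ℝ) T,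
        (b u t ω - stepOf (fun _ _ => (0:ℝ)) N (bN N) u t ω) ^ 2) ∂P) ≤ ψ N) :
    (∃ K : ℝ, 0 < K ∧ ∀ N : ℕ, 0 < N →
      (∫ ω, (∫ u in Icc (0:ℝ) 1, ∫ t in Icc (0:ℝ) T,
          (αhat u t ω - stepOf (fun _ _ => (0:ℝ)) N (αN N) u t ω) ^ 2) ∂P)
        ≤ K * (ψ N + Real.sqrt (cutNorm (fun u v => W u v - stepW N (w N) u v)))) ∧
    ((Tendsto (fun N : ℕ => cutNorm (fun u v => W u v - stepW N (w N) u v))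
        atTop (nhds 0)) →
      Tendsto (fun N : ℕ => ∫ ω, (∫ u in Icc (0:ℝ) 1, ∫ t in Icc (0:ℝ) T,
          (αhat u t ω - stepOf (fun _ _ => (0:ℝ)) N (αN N) u t ω) ^ 2) ∂P)
        atTop (nhds 0)) := by
  obtain ⟨CA, hAb⟩ := kernel_Bd hA
  obtain ⟨CB, hBb⟩ := kernel_Bd hBk
  obtain ⟨CC, hCb⟩ := kernel_Bd hCk
  obtain ⟨Cψ, hCψ⟩ := hψbdd
  have hCψ0 : 0 ≤ Cψ := (hψ0 0).trans (hCψ 0)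
  have hWa : ∀ u v, |W u v| ≤ 1 := fun u v => by
    rw [abs_of_nonneg (hW.2.2 u v).1]; exact (hW.2.2 u v).2
  obtain ⟨CW, hWb⟩ := Bd.of_bdd hW.1 hWa
  have hb3 : L3 T P b := ⟨hbmeas, hbL2⟩
  have hα3 : L3 T P αhat := ⟨hαhat.1.1, hαhat.1.2.2.2⟩
  set Ib : ℝ := ∫ q, (b q.1 q.2.1 q.2.2) ^ 2 ∂(mu3 T P) with hIb
  have hIb0 : 0 ≤ Ib := L2.sq_nonneg_int
  set CB' : ℝ := ∫ p, (Btil p.2 p.1) ^ 2 ∂((nuT T).prod (nuT T)) with hCB'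
  have hCB'0 : 0 ≤ CB' := integral_nonneg fun _ => sq_nonneg _
  have hCB0 : 0 ≤ CB := hBb.C0
  set M : ℝ := (2 * Ib + 2 * Cψ ^ 2) / (4 * c₀ ^ 2) with hM
  have hM0 : 0 ≤ M := by positivity
  set K : ℝ := 3 * (Cψ + 2 * (CB + CB') * M) / (4 * cW ^ 2) + 1 with hK
  have hK0 : 0 < K := by positivity
  have hU1 : ∀ N : ℕ, 0 < N → ∀ u v, |W u v - stepW N (w N) u v| ≤ 1 := by
    intro N hN u v
    rw [stepW_eq N hN, abs_le]
    have h1 := hW.2.2 u v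
    have h2 := hw01 N (idx N hN u) (idx N hN v)
    constructor <;> linarith [h1.1, h1.2, h2.1, h2.2]
  have main : ∀ N : ℕ, 0 < N →
      (∫ ω, (∫ u in Icc (0:ℝ) 1, ∫ t in Icc (0:ℝ) T,
          (αhat u t ω - stepOf (fun _ _ => (0:ℝ)) N (αN N) u t ω) ^ 2) ∂P)
        ≤ K * (ψ N + Real.sqrt (cutNorm (fun u v => W u v - stepW N (w N) u v))) := by
    intro N hN
    have hNa := hNashN N hN
    have hαs : L3 T P (stepP hN (αN N)) := stepP_L3 hN fun i => adm_L2 (hNa.1 i)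
    have hbs : L3 T P (stepP hN (bN N)) := stepP_L3 hN fun i => adm_L2 (hbN N i)
    have hsm := stepW_meas hN (w N)
    obtain ⟨CV, hVb⟩ := Bd.of_bdd (U := stepW N (w N)) hsm (fun u v => by
      rw [stepW_eq N hN, abs_of_nonneg (hw01 N _ _).1]; exact (hw01 N _ _).2)
    have hUb := cut_op (U := fun u v => W u v - stepW N (w N) u v) (hW.1.sub hsm) (hU1 N hN)
      (fun u v => by rw [hW.2.1 u v, stepW_eq N hN, stepW_eq N hN, hwsymm])
    set X : ℝ := Real.sqrt (cutNorm (fun u v => W u v - stepW N (w N) u v)) with hX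
    have hX0 : 0 ≤ X := Real.sqrt_nonneg _
    -- noise
    have hbb : L2 (mu3 T P) (fun q => b q.1 q.2.1 q.2.2 - stepP hN (bN N) q.1 q.2.1 q.2.2) :=
      L2.sub hb3 hbs
    have hn : ∫ q, (b q.1 q.2.1 q.2.2 - stepP hN (bN N) q.1 q.2.1 q.2.2) ^ 2 ∂(mu3 T P)
        ≤ ψ N ^ 2 := by
      have h1 := hnoise N hN
      simp only [stepOf_eq _ N hN] at h1
      rw [(int3 (F := fun u t ω => (b u t ω - stepP hN (bN N) u t ω) ^ 2) hbb.2).2]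
      exact (Real.sqrt_le_left (hψ0 N)).1 h1
    -- bound on the step profile
    have hbsb : ∫ q, (stepP hN (bN N) q.1 q.2.1 q.2.2) ^ 2 ∂(mu3 T P)
        ≤ 2 * Ib + 2 * ψ N ^ 2 := by
      have h1 : ∫ q, (stepP hN (bN N) q.1 q.2.1 q.2.2) ^ 2 ∂(mu3 T P)
          ≤ 2 * Ib + 2 * ∫ q, (b q.1 q.2.1 q.2.2 - stepP hN (bN N) q.1 q.2.1 q.2.2) ^ 2 ∂(mu3 T P) := by
        rw [hIb, ← integral_const_mul, ← integral_const_mul,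
          ← integral_add (hb3.2.const_mul 2) (hbb.2.const_mul 2)]
        refine integral_mono hbs.2 (iadd (hb3.2.const_mul 2) (hbb.2.const_mul 2)) fun q => ?_
        have key : ∀ x y : ℝ, y ^ 2 ≤ 2 * x ^ 2 + 2 * (x - y) ^ 2 := by
          intro x y; nlinarith [sq_nonneg (2 * x - y)]
        exact key _ _
      linarith
    have hgb := graph_bound hAb hBb hCb hN (hwdiag N) (hwsymm N) (hw01 N) (hbN N) hbstar
      (fun i => (hcN N i).1) hNa hc₀ (hcoercN N hN)
    have hψsq : ψ N ^ 2 ≤ Cψ ^ 2 := pow_le_pow_left₀ (hψ0 N) (hCψ N) 2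
    have hαM : ∫ q, (stepP hN (αN N) q.1 q.2.1 q.2.2) ^ 2 ∂(mu3 T P) ≤ M := by
      rw [hM, le_div_iff₀ (by positivity)]
      linarith
    -- stability
    have adm : ∀ᵐ u ∂rho, Admissible T F P
        (fun t ω => αhat u t ω + (-1) * stepP hN (αN N) u t ω) := by
      have hmem : ∀ᵐ u ∂rho, u ∈ Icc (0:ℝ) 1 := ae_restrict_mem measurableSet_Icc
      have hsq : ∀ᵐ u ∂rho, SqInt T P (αhat u) := hαhat.1.2.2.1
      filter_upwards [hmem, hsq] with u hu hsq
      have ha : Admissible T F P (αhat u) := ⟨hαhat.1.2.1 u hu, hsq⟩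
      have hd := hNa.1 (idx N hN u)
      refine ⟨fun i => ?_, ((adm_L2 ha).add ((adm_L2 hd).smul (-1))).2⟩
      exact (ha.1 i).add ((hd.1 i).const_mul (-1))
    have hst := stability (F := F) (lam := lam) hAb hBb hWb hVb hUb hW.2.1 hcW hcoercW hα3 hαs hb3 hbs adm
      (graphon_foc hAb hBb hCb hWb hb3 hbstar (fun u => (hc u).1) hαhat)
      (Eventually.of_forall fun u δ hδ => graph_foc' hAb hBb hCb hN (hwdiag N) (hbN N) hbstar
        (fun i => (hcN N i).1) hNa u hδ)
    have hΔ : L2 (mu3 T P) (fun q => αhat q.1 q.2.1 q.2.2 - stepP hN (αN N) q.1 q.2.1 q.2.2) :=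
      L2.sub hα3 hαs
    have hconv := (int3 (F := fun u t ω => (αhat u t ω - stepP hN (αN N) u t ω) ^ 2) hΔ.2).2
    simp only [stepOf_eq _ N hN]
    refine le_trans (le_of_eq hconv.symm) ?_
    have h1 : (2 * X) * (CB + CB') * (∫ q, (stepP hN (αN N) q.1 q.2.1 q.2.2) ^ 2 ∂(mu3 T P))
        ≤ (2 * X) * (CB + CB') * M := mul_le_mul_of_nonneg_left hαM (by positivity)
    have h2 : ψ N ^ 2 ≤ Cψ * ψ N := by nlinarith [hψ0 N, hCψ N]
    have h3 : 3 * (Cψ * ψ N + (2 * X) * (CB + CB') * M)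
        ≤ 3 * (Cψ + 2 * (CB + CB') * M) * (ψ N + X) := by
      have q1 : 0 ≤ Cψ * X := mul_nonneg hCψ0 hX0
      have q2 : 0 ≤ (CB + CB') * M * ψ N := mul_nonneg (by positivity) (hψ0 N)
      nlinarith
    have h4 : 4 * cW ^ 2 * (∫ q, (αhat q.1 q.2.1 q.2.2 - stepP hN (αN N) q.1 q.2.1 q.2.2) ^ 2 ∂(mu3 T P))
        ≤ 3 * (Cψ + 2 * (CB + CB') * M) * (ψ N + X) := by
      refine hst.trans (le_trans ?_ h3)
      refine mul_le_mul_of_nonneg_left ?_ (by norm_num)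
      exact add_le_add (hn.trans h2) h1
    have h5 : (∫ q, (αhat q.1 q.2.1 q.2.2 - stepP hN (αN N) q.1 q.2.1 q.2.2) ^ 2 ∂(mu3 T P))
        ≤ 3 * (Cψ + 2 * (CB + CB') * M) / (4 * cW ^ 2) * (ψ N + X) := by
      rw [div_mul_eq_mul_div, le_div_iff₀ (by positivity)]
      linarith
    refine h5.trans ?_
    have h6 : 0 ≤ ψ N + X := add_nonneg (hψ0 N) hX0
    rw [hK, add_mul, one_mul]
    linarith
  refine ⟨⟨K, hK0, main⟩, fun hcut => ?_⟩
  have hlim : Tendsto (fun N : ℕ => K * (ψ N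
      + Real.sqrt (cutNorm (fun u v => W u v - stepW N (w N) u v)))) atTop (nhds 0) := by
    have h1 := (Real.continuous_sqrt.tendsto 0).comp hcut
    have h2 := (hψlim.add h1).const_mul K
    simpa using h2
  refine tendsto_of_tendsto_of_tendsto_of_le_of_le' tendsto_const_nhds hlim ?_ ?_
  · exact Eventually.of_forall fun N => integral_nonneg fun ω => integral_nonneg fun u =>
      integral_nonneg fun t => sq_nonneg _
  · filter_upwards [eventually_gt_atTop 0] with N hN
    exact main N hN
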